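/- arXiv:0812.0667 — 7 statements merged into one kernel-verified Lean document; each statement's English description precedes it below -/
import Mathlib

section
/- Let R be a commutative ring, r ≥ 2, ℓ ≥ 2, and let T = {T^{(a)}_m(u)} be a regular solution in R of the level ℓ restricted T-system 𝕋_ℓ(C_r) with unit boundary condition (i.e., a regular solution of 𝕋̃_ℓ(C_r) in which additionally T^{(r)}_ℓ(u) = 1 for all u ∈ (1/2)ℤ). Then, with t_a = 2 for 1 ≤ a ≤ r−1 and t_r = 1: (1) half-periodicity: T^{(a)}_m(u + r + 1 + ℓ) = T^{(a)}_{t_a ℓ − m}(u) for all 1 ≤ a ≤ r, 1 ≤ m ≤ t_a ℓ − 1, u ∈ (1/2)ℤ; (2) periodicity: T^{(a)}_m(u + 2(r + 1 + ℓ)) = T^{(a)}_m(u). -/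
section helpers
open Matrix

theorem jac_aux {R : Type*} [CommRing R] {m n : Type*} [Fintype m] [Fintype n] [DecidableEq m]
    [DecidableEq n] (A : Matrix (m ⊕ n) (m ⊕ n) R) :
    A.det * (A.adjugate).toBlocks₁₁.det = A.det ^ (Fintype.card m) * A.toBlocks₂₂.det := by
  have h1 : A * fromBlocks A.adjugate.toBlocks₁₁ 0 A.adjugate.toBlocks₂₁ 1
      = fromBlocks (A.det • 1) A.toBlocks₁₂ 0 A.toBlocks₂₂ := by
    have h := mul_adjugate A
    ext i j
    rcases j with j | j
    · have := congrFun (congrFun h i) (Sum.inl j)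
      rw [mul_apply] at this
      rw [mul_apply]
      have e : ∀ k, fromBlocks A.adjugate.toBlocks₁₁ 0 A.adjugate.toBlocks₂₁ (1 : Matrix n n R) k (Sum.inl j)
          = A.adjugate k (Sum.inl j) := by
        rintro (k | k) <;> rfl
      simp only [e]
      rw [this]
      rcases i with i | i <;> simp [Matrix.one_apply]
    · rw [mul_apply, Fintype.sum_sum_type]
      rcases i with i | i <;> simp [Matrix.one_apply, toBlocks₁₂, toBlocks₂₂]
  have h2 := congrArg det h1
  rw [det_mul, det_fromBlocks_zero₁₂, det_fromBlocks_zero₂₁, det_one, mul_one, det_smul, det_one,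
    mul_one] at h2
  exact h2

theorem jac2 {R : Type*} [CommRing R] {n : Type*} [Fintype n]
    [DecidableEq n] (A : Matrix (Fin 2 ⊕ n) (Fin 2 ⊕ n) R) :
    (A.adjugate).toBlocks₁₁.det = A.det * A.toBlocks₂₂.det := by
  let X := mvPolynomialX (Fin 2 ⊕ n) (Fin 2 ⊕ n) ℤ
  have hX : X.adjugate.toBlocks₁₁.det = X.det * X.toBlocks₂₂.det := by
    have h := jac_aux X
    have h0 : X.det ≠ 0 := det_mvPolynomialX_ne_zero _ _
    apply mul_left_cancel₀ h0
    rw [h, Fintype.card_fin]; ring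
  let f : MvPolynomial ((Fin 2 ⊕ n) × (Fin 2 ⊕ n)) ℤ →+* R :=
    MvPolynomial.eval₂Hom (Int.castRingHom R) (fun p => A p.1 p.2)
  have hf : f.mapMatrix X = A := by
    ext i j; simp [f, X, mvPolynomialX]
  have h := congrArg f hX
  rw [map_mul, RingHom.map_det, RingHom.map_det, RingHom.map_det, hf] at h
  have e1 : f.mapMatrix X.adjugate.toBlocks₁₁ = A.adjugate.toBlocks₁₁ := by
    rw [← hf, ← RingHom.map_adjugate]; rfl
  have e2 : f.mapMatrix X.toBlocks₂₂ = A.toBlocks₂₂ := by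
    rw [← hf]; rfl
  rw [e1, e2] at h
  exact h

/-- consecutive minor -/
def mnr {R : Type*} [CommRing R] (E : ℤ → ℤ → R) (n : ℕ) (p q : ℤ) : R :=
  (Matrix.of fun i j : Fin n => E (p + (i : ℕ)) (q + (j : ℕ))).det

noncomputable def cornerEquiv (n : ℕ) : Fin 2 ⊕ Fin n ≃ Fin (n + 2) :=
  Equiv.ofBijective
    (Sum.elim ![0, Fin.last (n+1)] (fun i => i.succ.castSucc))
    (by
      rw [Fintype.bijective_iff_injective_and_card]
      constructor
      · rintro (i | i) (j | j) h
        · fin_cases i <;> fin_cases j <;> simp_all [Fin.ext_iff]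
        · fin_cases i <;> simp_all [Fin.ext_iff] <;> omega
        · fin_cases j <;> simp_all [Fin.ext_iff] <;> omega
        · simp_all [Fin.ext_iff]
      · simp [add_comm])

theorem dj {R : Type*} [CommRing R] (E : ℤ → ℤ → R) (n : ℕ) (p q : ℤ) :
    mnr E (n+1) p q * mnr E (n+1) (p+1) (q+1)
      = mnr E n (p+1) (q+1) * mnr E (n+2) p q + mnr E (n+1) p (q+1) * mnr E (n+1) (p+1) q := by
  let A : Matrix (Fin (n+2)) (Fin (n+2)) R := Matrix.of fun i j => E (p + (i : ℕ)) (q + (j : ℕ))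
  have h := jac2 (A.submatrix (cornerEquiv n) (cornerEquiv n))
  rw [adjugate_submatrix_equiv_self, det_submatrix_equiv_self, det_fin_two] at h
  have c0 : cornerEquiv n (Sum.inl 0) = 0 := rfl
  have c1 : cornerEquiv n (Sum.inl 1) = Fin.last (n+1) := rfl
  simp only [toBlocks₁₁, submatrix_apply, of_apply, c0, c1, adjugate_fin_succ_eq_det_submatrix] at h
  have e1 : (A.submatrix (Fin.succAbove 0) (Fin.succAbove 0)).det = mnr E (n+1) (p+1) (q+1) := by
    unfold mnr; congr 1; ext i j; simp [A]; congr 1 <;> ring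
  have e2 : (A.submatrix (Fin.last _).succAbove (Fin.last _).succAbove).det = mnr E (n+1) p q := by
    unfold mnr; congr 1; ext i j; simp [A]
  have e3 : (A.submatrix (Fin.last _).succAbove (Fin.succAbove 0)).det = mnr E (n+1) p (q+1) := by
    unfold mnr; congr 1; ext i j; simp [A]; congr 1; ring
  have e4 : (A.submatrix (Fin.succAbove 0) (Fin.last _).succAbove).det = mnr E (n+1) (p+1) q := by
    unfold mnr; congr 1; ext i j; simp [A]; congr 1; ring
  have e5 : (A.submatrix (cornerEquiv n) (cornerEquiv n)).toBlocks₂₂.det = mnr E n (p+1) (q+1) := by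
    unfold mnr; congr 1; ext i j
    have : ∀ i, cornerEquiv n (Sum.inr i) = i.succ.castSucc := fun _ => rfl
    simp [A, toBlocks₂₂, this]; congr 1 <;> ring
  rw [e1, e2, e3, e4, e5] at h
  have e6 : A.det = mnr E (n+2) p q := rfl
  rw [e6] at h
  simp only [Fin.val_zero, Fin.val_last] at h
  have s : ((-1 : R) ^ (n+1)) * (-1)^(n+1) = 1 := by
    rw [← mul_pow]; simp
  simp only [add_zero, zero_add, pow_zero, one_mul, pow_add _ (n+1) (n+1), s] at h
  linear_combination h + (mnr E (n+1) p (q+1) * mnr E (n+1) (p+1) q) * s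

theorem alt_det {R : Type*} [CommRing R] (n : ℕ) (hn : n % 2 = 1) (A : Matrix (Fin n) (Fin n) R)
    (h0 : ∀ i, A i i = 0) (hs : ∀ i j, A j i = - A i j) : A.det = 0 := by
  let X : Matrix (Fin n) (Fin n) (MvPolynomial (Fin n × Fin n) ℤ) := Matrix.of fun i j =>
    if i < j then MvPolynomial.X (i, j) else if j < i then - MvPolynomial.X (j, i) else 0
  have hX : X.det = 0 := by
    have ht : Xᵀ = - X := by
      ext1 i j
      rcases lt_trichotomy i j with h | h | h
      · simp [X, h, h.not_gt]
      · simp [X, h]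
      · simp [X, h, h.not_gt]
    have h1 := congrArg det ht
    rw [det_transpose, det_neg, Fintype.card_fin, Odd.neg_one_pow (Nat.odd_iff.2 hn)] at h1
    have : (2 : MvPolynomial (Fin n × Fin n) ℤ) * X.det = 0 := by linear_combination h1
    rcases mul_eq_zero.1 this with h | h
    · exact absurd h two_ne_zero
    · exact h
  let f : MvPolynomial (Fin n × Fin n) ℤ →+* R :=
    MvPolynomial.eval₂Hom (Int.castRingHom R) (fun p => A p.1 p.2)
  have hf : f.mapMatrix X = A := by
    ext i j
    rcases lt_trichotomy i j with h | h | h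
    · simp [f, X, h]
    · simp [f, X, h, h0]
    · simp [f, X, h, h.not_gt, hs j i]
  have h := congrArg f hX
  rwa [RingHom.map_det, hf, map_zero] at h

theorem mnr_tri {R : Type*} [CommRing R] (E : ℤ → ℤ → R) (hlow : ∀ p q, q < p → E p q = 0)
    (hdiag : ∀ p, E p p = 1) (n : ℕ) (p : ℤ) : mnr E n p p = 1 := by
  unfold mnr
  rw [det_of_isUpperTriangular]
  · simp [hdiag]
  · intro i j hij
    simp only [of_apply]
    apply hlow
    have : (j : ℕ) < (i : ℕ) := hij
    omega

def xs {R : Type*} [CommRing R] (E : ℤ → ℤ → R) (p : ℤ) : ℕ → R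
  | 0 => 1
  | n+1 => - ∑ i : Fin (n+1), xs E p i * E (p + (i : ℕ)) (p + (n + 1 : ℕ))

theorem xs_sum {R : Type*} [CommRing R] (E : ℤ → ℤ → R)
    (hdiag : ∀ p, E p p = 1) (p : ℤ) (n : ℕ) :
    ∑ i ∈ Finset.range (n+2), xs E p i * E (p + (i : ℕ)) (p + (n + 1 : ℕ)) = 0 := by
  rw [Finset.sum_range_succ, hdiag, xs, Finset.sum_range]
  ring

theorem xs_eq {R : Type*} [CommRing R] (E : ℤ → ℤ → R) (hlow : ∀ p q, q < p → E p q = 0)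
    (hdiag : ∀ p, E p p = 1) (p : ℤ) (n : ℕ) : xs E p n = (-1) ^ n * mnr E n p (p+1) := by
  let U : Matrix (Fin (n+1)) (Fin (n+1)) R := Matrix.of fun i j => E (p + (i : ℕ)) (p + (j : ℕ))
  have hU : U.det = 1 := mnr_tri E hlow hdiag (n+1) p
  let x : Fin (n+1) → R := fun i => xs E p i
  have hx : x ᵥ* U = Pi.single 0 1 := by
    ext j
    have h1 : (x ᵥ* U) j = ∑ i ∈ Finset.range (n+1), xs E p i * E (p + (i : ℕ)) (p + (j : ℕ)) := by
      rw [Finset.sum_range]; rfl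
    rw [h1]
    have h2 : ∑ i ∈ Finset.range (n+1), xs E p i * E (p + (i : ℕ)) (p + (j : ℕ))
        = ∑ i ∈ Finset.range ((j:ℕ)+1), xs E p i * E (p + (i : ℕ)) (p + (j : ℕ)) := by
      symm
      apply Finset.sum_subset
      · intro i; simp only [Finset.mem_range]; omega
      · intro i _ hi
        simp only [Finset.mem_range] at hi
        rw [hlow, mul_zero]; omega
    rw [h2]
    refine Fin.cases ?_ (fun k => ?_) j
    · simp [xs, hdiag]
    · have := xs_sum E hdiag p k
      simpa using this
  have h3 : x = Pi.single 0 1 ᵥ* U.adjugate := by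
    rw [← hx, vecMul_vecMul, mul_adjugate, hU, one_smul, vecMul_one]
  have h4 := congrFun h3 (Fin.last n)
  rw [single_one_vecMul] at h4
  simp only [row, adjugate_fin_succ_eq_det_submatrix] at h4
  have e : (U.submatrix (Fin.last _).succAbove (Fin.succAbove 0)).det = mnr E n p (p+1) := by
    unfold mnr; congr 1; ext i j; simp [U]; congr 1; ring
  rw [e] at h4
  simpa [x] using h4

theorem band {R : Type*} [CommRing R] (E : ℤ → ℤ → R) (hlow : ∀ p q, q < p → E p q = 0)
    (hdiag : ∀ p, E p p = 1) (L N : ℕ) (hN1 : 1 ≤ N) (hLe : Even L)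
    (hN : ∀ p, E p (p + N) = -1) (hhigh : ∀ p q : ℤ, p + N < q → E p q = 0)
    (hL : ∀ (p : ℤ) (b : ℕ), b ≤ N → mnr E L p (p + b) = 1)
    (hL1 : ∀ (p : ℤ) (b : ℕ), 1 ≤ b → b + 1 ≤ N → mnr E (L+1) p (p + b) = 0) (p c : ℤ) :
    ∑ i ∈ Finset.range (L+1), (-1) ^ i * mnr E i p (p+1) * E (p + (i : ℕ)) c
      = (if c = p then 1 else 0) - (if c = p + (N + L) then 1 else 0) := by
  simp only [← xs_eq E hlow hdiag]
  let y : ℤ → R := fun c => ∑ i ∈ Finset.range (L+1), xs E p i * E (p + (i : ℕ)) c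
  have y1 : ∀ k : ℕ, 1 ≤ k → k ≤ L → y (p + k) = 0 := by
    intro k hk hkL
    obtain ⟨k, rfl⟩ : ∃ k', k = k' + 1 := ⟨k - 1, by omega⟩
    rw [← xs_sum E hdiag p k]
    symm
    apply Finset.sum_subset
    · intro i; simp only [Finset.mem_range]; omega
    · intro i _ hi
      simp only [Finset.mem_range] at hi
      rw [hlow, mul_zero]; push_cast; omega
  have y2 : ∀ k : ℕ, 1 ≤ k → k < N + L → y (p + k) = 0 := by
    intro k
    induction k using Nat.strong_induction_on with
    | _ k ih =>
    intro hk hkN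
    by_cases hkL : k ≤ L
    · exact y1 k hk hkL
    obtain ⟨b, rfl⟩ : ∃ b, k = b + L := ⟨k - L, by omega⟩
    let A : Matrix (Fin (L+1)) (Fin (L+1)) R :=
      Matrix.of fun i j => E (p + (i : ℕ)) (p + b + (j : ℕ))
    have hA : A.det = 0 := hL1 p b (by omega) (by omega)
    let x : Fin (L+1) → R := fun i => xs E p i
    have hx : x ᵥ* A = Pi.single (Fin.last L) (y (p + (b + L : ℕ))) := by
      ext j
      have h1 : (x ᵥ* A) j = y (p + b + (j : ℕ)) := by
        simp only [y]
        rw [Finset.sum_range]; rfl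
      rw [h1]
      by_cases hj : j = Fin.last L
      · subst hj; simp [add_assoc]
      · rw [Pi.single_eq_of_ne hj]
        have : (j : ℕ) < L := by
          have := j.2
          have h' : (j : ℕ) ≠ L := fun h => hj (Fin.ext h)
          omega
        have := ih (b + j) (by omega) (by omega) (by omega)
        rw [← this]; push_cast; ring_nf
    have h2 : x ᵥ* (A * A.adjugate) = Pi.single (Fin.last L) (y (p + (b + L : ℕ))) ᵥ* A.adjugate := by
      rw [← hx, vecMul_vecMul]
    rw [mul_adjugate, hA, zero_smul, vecMul_zero] at h2
    have h3 := congrFun h2 0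
    rw [single_vecMul] at h3
    simp only [row, Pi.smul_apply, Pi.zero_apply, adjugate_fin_succ_eq_det_submatrix, smul_eq_mul] at h3
    have e : (A.submatrix (Fin.succAbove 0) (Fin.last _).succAbove).det
        = mnr E L (p+1) (p+1+(b-1 : ℕ)) := by
      unfold mnr; congr 1; ext i j; simp [A]; congr 1
      · ring
      · push_cast [Nat.cast_sub (show 1 ≤ b by omega)]; ring
    rw [e, hL _ _ (by omega)] at h3
    have u : IsUnit ((-1 : R) ^ ((0 : Fin (L+1)) + Fin.last L : ℕ) * 1) := by
      rw [mul_one]; exact (isUnit_one.neg).pow _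
    exact (u.mul_left_eq_zero).1 h3.symm
  change y c = _
  rcases lt_trichotomy c p with h | h | h
  · rw [if_neg (by omega), if_neg (by omega), sub_zero]
    apply Finset.sum_eq_zero
    intro i _
    rw [hlow, mul_zero]; omega
  · subst h
    rw [if_pos rfl, if_neg (by omega), sub_zero]
    simp only [y]
    rw [Finset.sum_eq_single 0]
    · simp [xs, hdiag]
    · intro i _ hi
      rw [hlow, mul_zero]; omega
    · simp
  · rw [if_neg (by omega), zero_sub]
    obtain ⟨k, rfl⟩ : ∃ k : ℕ, c = p + k := ⟨(c - p).toNat, by omega⟩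
    rcases lt_trichotomy k (N + L) with h' | h' | h'
    · rw [if_neg (by omega), neg_zero]
      exact y2 k (by omega) h'
    · subst h'
      rw [if_pos (by push_cast; ring)]
      simp only [y]
      rw [Finset.sum_range_succ, Finset.sum_eq_zero, zero_add, xs_eq E hlow hdiag]
      · have := hL p 1 hN1
        push_cast at this
        rw [this, hLe.neg_one_pow]
        have := hN (p + L)
        rw [show p + ((N + L : ℕ) : ℤ) = p + L + N by push_cast; ring, this]; ring
      · intro i hi
        simp only [Finset.mem_range] at hi
        rw [hhigh, mul_zero]; push_cast; omega
    · rw [if_neg (by omega), neg_zero]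
      apply Finset.sum_eq_zero
      intro i hi
      simp only [Finset.mem_range] at hi
      rw [hhigh, mul_zero]; omega

theorem skewband {R : Type*} [CommRing R] (E : ℤ → ℤ → R) (L h : ℕ)
    (g : ℤ → ℕ → R)
    (hskew : ∀ p q, E p q = - E (q - h) (p + h))
    (hh : 1 ≤ h)
    (hg : ∀ p c, ∑ i ∈ Finset.range (L+1), g p i * E (p + (i : ℕ)) c
      = (if c = p then 1 else 0) - (if c = p + (2 * h + L) then 1 else 0))
    (p : ℤ) (m : ℕ) (hm : m ≤ L) :
    g (p + h + L - m) m = g p (L - m) := by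
  have h2 : ∀ p c : ℤ, ∑ i ∈ Finset.range (L+1), E c (p + (i : ℕ)) * g (p - h) i
      = (if c = p + L then 1 else 0) - (if c = p - 2 * h then 1 else 0) := by
    intro p c
    have := hg (p - h) (c + h)
    have e : ∑ i ∈ Finset.range (L+1), E c (p + (i : ℕ)) * g (p - h) i
        = - ∑ i ∈ Finset.range (L+1), g (p - h) i * E (p - h + (i : ℕ)) (c + h) := by
      rw [← Finset.sum_neg_distrib]
      apply Finset.sum_congr rfl
      intro i _
      rw [hskew c]
      rw [show p + (i : ℤ) - h = p - h + i by ring]; ring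
    rw [e, this, neg_sub]
    congr 1
    · congr 1; apply propext; constructor <;> intro <;> linarith
    · congr 1; apply propext; constructor <;> intro <;> linarith
  let p' : ℤ := p + 2 * h + L - m
  have key : ∑ i ∈ Finset.range (L+1), g p i * ∑ j ∈ Finset.range (L+1), E (p + (i : ℕ)) (p' + (j : ℕ)) * g (p' - h) j
     = ∑ j ∈ Finset.range (L+1), (∑ i ∈ Finset.range (L+1), g p i * E (p + (i : ℕ)) (p' + (j : ℕ))) * g (p' - h) j := by
    simp only [Finset.mul_sum, Finset.sum_mul]
    rw [Finset.sum_comm]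
    simp only [mul_assoc]
  simp only [h2, hg] at key
  rw [Finset.sum_eq_single (L - m), Finset.sum_eq_single m] at key
  · rw [if_neg (by omega), if_pos (by omega), if_neg (by omega), if_pos (by omega)] at key
    rw [show p' - h = p + h + L - m by simp only [p']; ring] at key
    linear_combination key
  · intro j hj hjm
    simp only [Finset.mem_range] at hj
    rw [if_neg (by omega), if_neg (by omega)]; ring
  · intro hj; exfalso; simp only [Finset.mem_range] at hj; omega
  · intro j hj hjm
    simp only [Finset.mem_range] at hj
    rw [if_neg (by omega), if_neg (by omega)]; ring
  · intro hj; exfalso; simp only [Finset.mem_range] at hj; omega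

theorem mnr_skew {R : Type*} [CommRing R] (E : ℤ → ℤ → R) (h : ℕ)
    (hskew : ∀ p q, E p q = - E (q - h) (p + h)) (n : ℕ) (p q : ℤ) :
    mnr E n p q = (-1) ^ n * mnr E n (q - h) (p + h) := by
  unfold mnr
  rw [← det_transpose (Matrix.of fun i j : Fin n => E (q - h + (i : ℕ)) (p + h + (j : ℕ)))]
  have := det_neg (Matrix.of fun i j : Fin n => E (q - h + (i : ℕ)) (p + h + (j : ℕ)))ᵀ
  rw [Fintype.card_fin] at this
  rw [← this]
  congr 1
  ext i j
  simp only [of_apply, neg_apply, transpose_apply]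
  rw [hskew]
  congr 2 <;> ring

theorem mnr_odd {R : Type*} [CommRing R] (E : ℤ → ℤ → R) (h : ℕ)
    (hskew : ∀ p q, E p q = - E (q - h) (p + h)) (h0 : ∀ p, E p (p + h) = 0)
    (n : ℕ) (hn : n % 2 = 1) (p : ℤ) :
    mnr E n p (p + h) = 0 := by
  apply alt_det n hn
  · intro i
    simp only [of_apply]
    rw [← h0 (p + (i : ℕ))]; congr 1; ring
  · intro i j
    simp only [of_apply]
    rw [hskew]; congr 2 <;> ring

def ee {R : Type*} [CommRing R] (r : ℕ) (S : ℕ → ℕ → ℤ → R) (a v : ℤ) : R :=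
  if 0 ≤ a ∧ a ≤ r + 1 then S a.toNat 1 v
  else if r + 1 < a ∧ a ≤ 2 * (r + 1) then - S (2 * (r + 1) - a).toNat 1 v else 0

theorem core {R : Type*} [CommRing R] (r L : ℕ) (hr : 1 ≤ r) (hLe : L % 2 = 0) (hL2 : 2 ≤ L)
    (S : ℕ → ℕ → ℤ → R)
    (hS0 : ∀ m v, S 0 m v = 1)
    (hSm0 : ∀ a v, a ≤ r + 1 → S a 0 v = 1)
    (hSL : ∀ a v, a ≤ r + 1 → S a L v = 1)
    (hu : ∀ a m v, a ≤ r → m ≤ L → IsUnit (S a m v))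
    (hu1 : ∀ m v, m ≤ L → m % 2 = 0 → IsUnit (S (r+1) m v))
    (hodd : ∀ m v, m % 2 = 1 → S (r+1) m v = 0)
    (h3 : ∀ a m v, 1 ≤ a → a ≤ r → m + 2 ≤ L → S a (m+1) (v-1) * S a (m+1) (v+1)
      = S a m v * S a (m+2) v + S (a-1) (m+1) v * S (a+1) (m+1) v)
    (h4 : ∀ m v, m + 2 ≤ L → m % 2 = 0 → S (r+1) m v * S (r+1) (m+2) v = S r (m+1) v ^ 2)
    (m : ℕ) (v : ℤ) (hm : m ≤ L) :
    S 1 m (v + (2 * (r + 1) + L)) = S 1 (L - m) v := by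
  -- reduce to fixed parity offset
  let s : ℤ := v - (L - m)
  let E : ℤ → ℤ → R := fun p q => ee r S (q - p) (q + p + s)
  have hskew : ∀ p q, E p q = - E (q - (r+1 : ℕ)) (p + (r+1 : ℕ)) := by
    intro p q
    simp only [E, ee]
    rw [show p + ((r + 1 : ℕ) : ℤ) - (q - ((r + 1 : ℕ) : ℤ)) = 2 * (r + 1) - (q - p) by push_cast; ring,
      show p + ((r + 1 : ℕ) : ℤ) + (q - ((r + 1 : ℕ) : ℤ)) + s = q + p + s by ring]
    generalize q - p = a
    generalize q + p + s = w
    rcases lt_trichotomy a (r + 1) with h | h | h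
    · by_cases ha : 0 ≤ a
      · rw [if_pos (by omega), if_neg (by omega), if_pos (by omega), neg_neg]
        congr 1; omega
      · rw [if_neg (by omega), if_neg (by omega), if_neg (by omega), if_neg (by omega), neg_zero]
    · subst h
      rw [if_pos (by omega), if_pos (by omega)]
      rw [show ((r : ℤ) + 1).toNat = r + 1 by omega,
        show (2 * ((r : ℤ) + 1) - (r + 1)).toNat = r + 1 by omega, hodd _ _ rfl, neg_zero]
    · by_cases ha : a ≤ 2 * (r + 1)
      · rw [if_neg (by omega), if_pos (by omega), if_pos (by omega)]
      · rw [if_neg (by omega), if_neg (by omega), if_neg (by omega), if_neg (by omega), neg_zero]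
  have hE : ∀ (a : ℕ) p, a ≤ r + 1 → E p (p + a) = S a 1 (2 * p + a + s) := by
    intro a p ha
    simp only [E, ee]
    rw [if_pos (by omega), show (p + (a : ℤ) - p).toNat = a by omega]
    congr 1; ring
  have hlow : ∀ p q, q < p → E p q = 0 := by
    intro p q hpq
    simp only [E, ee]
    rw [if_neg (by omega), if_neg (by omega)]
  have hdiag : ∀ p, E p p = 1 := by
    intro p
    have := hE 0 p (by omega)
    rw [hS0] at this
    simpa using this
  have hN : ∀ p, E p (p + (2 * (r + 1) : ℕ)) = -1 := by
    intro p
    rw [hskew]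
    rw [show p + ((2 * (r + 1) : ℕ) : ℤ) - ((r + 1 : ℕ) : ℤ) = p + ((r + 1 : ℕ) : ℤ) by push_cast; ring,
      hdiag]
  have hhigh : ∀ p q : ℤ, p + (2 * (r + 1) : ℕ) < q → E p q = 0 := by
    intro p q hpq
    rw [hskew, hlow, neg_zero]
    push_cast at *; omega
  have hz : ∀ p, E p (p + (r+1 : ℕ)) = 0 := by
    intro p; rw [hE _ _ le_rfl, hodd _ _ rfl]
  have hsym := mnr_skew E (r+1) hskew
  have hod := mnr_odd E (r+1) hskew hz
  -- one step of the recursion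
  have step : ∀ n, (∀ a ≤ r + 1, ∀ p : ℤ, mnr E n p (p + a) = S a n (2 * p + a + n - 1 + s)) →
      (∀ a ≤ r + 1, ∀ p : ℤ, mnr E (n+1) p (p + a) = S a (n+1) (2 * p + a + n + s)) →
      ∀ a : ℕ, 1 ≤ a → a ≤ r → ∀ p : ℤ,
        S a (n+1) (2 * p + a + n + s) * S a (n+1) (2 * p + a + n + 2 + s)
        = S a n (2 * p + a + n + 1 + s) * mnr E (n+2) p (p + a)
        + S (a-1) (n+1) (2 * p + a + n + 1 + s) * S (a+1) (n+1) (2 * p + a + n + 1 + s) := by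
    intro n h1 h2 a ha har p
    have h := dj E n p (p + a)
    rw [h2 a (by omega) p, show p + (a : ℤ) + 1 = p + 1 + a by ring, h2 a (by omega) (p+1),
      h1 a (by omega) (p+1), show p + 1 + (a : ℤ) = p + (a + 1 : ℕ) by push_cast; ring,
      h2 (a+1) (by omega), show p + (a : ℤ) = p + 1 + (a - 1 : ℕ) by omega,
      h2 (a-1) (by omega)] at h
    rw [show p + 1 + ((a - 1 : ℕ) : ℤ) = p + a by omega] at h
    have e1 : 2 * (p + 1) + (a : ℤ) + n + s = 2 * p + a + n + 2 + s := by ring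
    have e2 : 2 * (p + 1) + (a : ℤ) + n - 1 + s = 2 * p + a + n + 1 + s := by ring
    have e3 : 2 * p + ((a + 1 : ℕ) : ℤ) + n + s = 2 * p + a + n + 1 + s := by push_cast; ring
    have e4 : 2 * (p + 1) + ((a - 1 : ℕ) : ℤ) + n + s = 2 * p + a + n + 1 + s := by omega
    rw [e1, e2, e3, e4] at h
    rw [h]; ring
  have P : ∀ n, (n ≤ L → ∀ a ≤ r + 1, ∀ p : ℤ, mnr E n p (p + a) = S a n (2 * p + a + n - 1 + s)) ∧
     (n + 1 ≤ L → ∀ a ≤ r + 1, ∀ p : ℤ, mnr E (n+1) p (p + a) = S a (n+1) (2 * p + a + n + s)) := by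
    intro n
    induction n with
    | zero =>
      constructor
      · intro _ a ha p
        rw [hSm0 _ _ ha]; simp [mnr]
      · intro _ a ha p
        have := hE a p ha
        simp [mnr, this]
    | succ n ih =>
      have ih2 : n + 1 ≤ L → ∀ a ≤ r + 1, ∀ p : ℤ, mnr E (n+1) p (p + a) = S a (n+1) (2 * p + a + (n + 1 : ℕ) - 1 + s) := by
        intro h a ha p
        rw [ih.2 h a ha p]; congr 1; push_cast; ring
      refine ⟨ih2, ?_⟩
      intro hn a ha p
      have h1 := ih.1 (by omega)
      have h2 := ih.2 (by omega)
      have ew : 2 * p + (a : ℤ) + (n + 1 : ℕ) + s = 2 * p + a + n + 1 + s := by push_cast; ring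
      rw [ew]
      rcases Nat.eq_zero_or_pos a with h0 | h0
      · subst h0
        rw [hS0]; simpa using mnr_tri E hlow hdiag (n+2) p
      rcases Nat.lt_or_ge r a with har | har
      · obtain rfl : a = r + 1 := by omega
        rcases Nat.mod_two_eq_zero_or_one n with hn2 | hn2
        · have h := dj E n p (p + (r + 1 : ℕ))
          have q1 : mnr E (n+1) p (p + (r+1 : ℕ)) = 0 := hod _ (by omega) _
          have q2 : mnr E n (p+1) (p + (r+1 : ℕ) + 1) = S (r+1) n (2 * p + (r+1 : ℕ) + n + 1 + s) := by
            rw [show p + ((r + 1 : ℕ) : ℤ) + 1 = p + 1 + (r+1 : ℕ) by ring, h1 _ le_rfl]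
            congr 1; ring
          have q3 : mnr E (n+1) (p+1) (p + (r+1 : ℕ)) = S r (n+1) (2 * p + (r+1 : ℕ) + n + 1 + s) := by
            rw [show p + ((r + 1 : ℕ) : ℤ) = p + 1 + r by push_cast; ring, h2 _ (by omega)]
            congr 1; push_cast; ring
          have q4 : mnr E (n+1) p (p + (r+1 : ℕ) + 1) = - S r (n+1) (2 * p + (r+1 : ℕ) + n + 1 + s) := by
            rw [hsym, Odd.neg_one_pow (Nat.odd_iff.2 (by omega)), ← q3,
              show p + ((r + 1 : ℕ) : ℤ) + 1 - (r+1 : ℕ) = p + 1 by ring]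
            ring
          rw [q1, q2, q3, q4] at h
          have h' := h4 n (2 * p + (r+1 : ℕ) + n + 1 + s) (by omega) hn2
          apply (hu1 n (2 * p + (r+1 : ℕ) + n + 1 + s) (by omega) hn2).mul_left_cancel
          rw [show n + 1 + 1 = n + 2 from rfl]
          linear_combination -h - h'
        · rw [hodd _ _ (by omega)]
          exact hod _ (by omega) _
      · have h := step n h1 h2 a h0 har p
        have h' := h3 a n (2 * p + a + n + 1 + s) h0 har (by omega)
        rw [show 2 * p + (a : ℤ) + n + 1 + s - 1 = 2 * p + a + n + s by ring,
          show 2 * p + (a : ℤ) + n + 1 + s + 1 = 2 * p + a + n + 2 + s by ring] at h'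
        apply (hu a n (2 * p + a + n + 1 + s) har (by omega)).mul_left_cancel
        rw [show n + 1 + 1 = n + 2 from rfl]
        linear_combination h' - h
  -- values at level L and L+1
  have hL : ∀ (p : ℤ) (b : ℕ), b ≤ 2 * (r + 1) → mnr E L p (p + b) = 1 := by
    intro p b hb
    by_cases hb1 : b ≤ r + 1
    · rw [(P L).1 le_rfl b hb1 p, hSL _ _ hb1]
    · rw [hsym, Even.neg_one_pow (Nat.even_iff.2 hLe), one_mul]
      have := (P L).1 le_rfl (2 * (r + 1) - b) (by omega) (p + b - (r+1 : ℕ))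
      rw [hSL _ _ (by omega)] at this
      rw [← this]; congr 1; omega
  have hL1' : ∀ (p : ℤ) (b : ℕ), 1 ≤ b → b ≤ r → mnr E (L+1) p (p + b) = 0 := by
    intro p b hb hbr
    obtain ⟨n, rfl⟩ : ∃ n, L = n + 1 := ⟨L - 1, by omega⟩
    have h := step n ((P n).1 (by omega)) ((P n).2 le_rfl) b hb hbr p
    rw [hSL _ _ (by omega), hSL _ _ (by omega), hSL _ _ (by omega), hSL _ _ (by omega)] at h
    have h' : S b n (2 * p + b + n + 1 + s) * mnr E (n+2) p (p + b) = 0 := by linear_combination -h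
    exact ((hu b n _ hbr (by omega)).mul_right_eq_zero).1 h'
  have hL1 : ∀ (p : ℤ) (b : ℕ), 1 ≤ b → b + 1 ≤ 2 * (r + 1) → mnr E (L+1) p (p + b) = 0 := by
    intro p b hb hb2
    rcases lt_trichotomy b (r + 1) with h | h | h
    · exact hL1' p b hb (by omega)
    · subst h; exact hod _ (by omega) _
    · rw [hsym]
      have := hL1' (p + b - (r+1 : ℕ)) (2 * (r + 1) - b) (by omega) (by omega)
      rw [show p + ((r+1 : ℕ) : ℤ) = p + b - (r+1 : ℕ) + (2 * (r + 1) - b : ℕ) by omega, this, mul_zero]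
  have hb := band E hlow hdiag L (2 * (r + 1)) (by omega) (Nat.even_iff.2 hLe) hN hhigh hL hL1
  have hk := skewband E L (r+1) (fun p i => (-1) ^ i * mnr E i p (p+1)) hskew (by omega)
    (by intro p c; have := hb p c; push_cast at this ⊢; exact this) 0 m hm
  have g1 := (P m).1 hm 1 (by omega) (0 + (r+1 : ℕ) + L - m)
  have g2 := (P (L - m)).1 (by omega) 1 (by omega) 0
  rw [Nat.cast_one] at g1 g2
  rw [g1, g2] at hk
  have sg : ((-1 : R)) ^ (L - m) = (-1) ^ m := by
    rcases Nat.mod_two_eq_zero_or_one m with h | h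
    · rw [Even.neg_one_pow (Nat.even_iff.2 h), Even.neg_one_pow (Nat.even_iff.2 (by omega))]
    · rw [Odd.neg_one_pow (Nat.odd_iff.2 h), Odd.neg_one_pow (Nat.odd_iff.2 (by omega))]
  rw [sg] at hk
  have hk' := ((isUnit_one.neg).pow m : IsUnit ((-1 : R) ^ m)).mul_left_cancel hk
  rw [show v + (2 * ((r : ℤ) + 1) + L) = 2 * (0 + (r+1 : ℕ) + L - m) + 1 + m - 1 + s by
      simp only [s]; push_cast; ring, hk']
  congr 1; simp only [s]; omega

def SS {R : Type*} [CommRing R] (r : ℕ) (T : ℕ → ℕ → ℤ → R) (a m : ℕ) (v : ℤ) : R :=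
  if a < r then T a m v
  else if a = r then
    (if m % 2 = 0 then T r (m/2) (v-1) * T r (m/2) (v+1) else T r (m/2) v * T r (m/2+1) v)
  else (if m % 2 = 0 then T r (m/2) v ^ 2 else 0)

end helpers

/-- Periodicity of the level `ℓ` restricted T-system `𝕋_ℓ(C_r)` with the unit
boundary condition.  The half-integer spectral parameter `u ∈ (1/2)ℤ` is encoded by
the integer `v = 2u`; a shift of `u` by `1/2`, `1`, `r+1+ℓ` corresponds to a shift
of `v` by `1`, `2`, `2(r+1+ℓ)` respectively.  Here `t_a = 2` for `a ≤ r−1` and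
`t_r = 1`. -/
theorem restricted_T_Cr_unit_periodicity {R : Type*} [CommRing R]
    (r ℓ : ℕ) (hr : 2 ≤ r) (hℓ : 2 ≤ ℓ)
    (T : ℕ → ℕ → ℤ → R)
    (h0 : ∀ m v, T 0 m v = 1)
    (hm0 : ∀ a v, a ≤ r → T a 0 v = 1)
    (hm2ℓ : ∀ a v, 1 ≤ a → a ≤ r - 1 → T a (2 * ℓ) v = 1)
    (hmℓ : ∀ v, T r ℓ v = 1)
    (hunit1 : ∀ a m v, 1 ≤ a → a ≤ r - 1 → 1 ≤ m → m ≤ 2 * ℓ - 1 → IsUnit (T a m v))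
    (hunit2 : ∀ m v, 1 ≤ m → m ≤ ℓ - 1 → IsUnit (T r m v))
    (hsysA : ∀ a m v, 1 ≤ a → a ≤ r - 2 → 1 ≤ m → m ≤ 2 * ℓ - 1 →
      T a m (v - 1) * T a m (v + 1)
        = T a (m - 1) v * T a (m + 1) v + T (a - 1) m v * T (a + 1) m v)
    (hsysB : ∀ m v, 1 ≤ m → m ≤ ℓ - 1 →
      T (r - 1) (2 * m) (v - 1) * T (r - 1) (2 * m) (v + 1)
        = T (r - 1) (2 * m - 1) v * T (r - 1) (2 * m + 1) v
          + T (r - 2) (2 * m) v * (T r m (v - 1) * T r m (v + 1)))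
    (hsysC : ∀ m v, m ≤ ℓ - 1 →
      T (r - 1) (2 * m + 1) (v - 1) * T (r - 1) (2 * m + 1) (v + 1)
        = T (r - 1) (2 * m) v * T (r - 1) (2 * m + 2) v
          + T (r - 2) (2 * m + 1) v * (T r m v * T r (m + 1) v))
    (hsysD : ∀ m v, 1 ≤ m → m ≤ ℓ - 1 →
      T r m (v - 2) * T r m (v + 2)
        = T r (m - 1) v * T r (m + 1) v + T (r - 1) (2 * m) v) :
    (∀ a m v, 1 ≤ a → a ≤ r - 1 → 1 ≤ m → m ≤ 2 * ℓ - 1 →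
      T a m (v + 2 * ((r : ℤ) + 1 + ℓ)) = T a (2 * ℓ - m) v) ∧
    (∀ m v, 1 ≤ m → m ≤ ℓ - 1 →
      T r m (v + 2 * ((r : ℤ) + 1 + ℓ)) = T r (ℓ - m) v) ∧
    (∀ a m v, 1 ≤ a → a ≤ r - 1 → 1 ≤ m → m ≤ 2 * ℓ - 1 →
      T a m (v + 4 * ((r : ℤ) + 1 + ℓ)) = T a m v) ∧
    (∀ m v, 1 ≤ m → m ≤ ℓ - 1 →
      T r m (v + 4 * ((r : ℤ) + 1 + ℓ)) = T r m v) := by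
  have Slt : ∀ a m v, a < r → SS r T a m v = T a m v := by
    intro a m v h; simp [SS, h]
  have Sre : ∀ k v, SS r T r (2*k) v = T r k (v-1) * T r k (v+1) := by
    intro k v; simp [SS]
  have Sro : ∀ k v, SS r T r (2*k+1) v = T r k v * T r (k+1) v := by
    intro k v
    have h1 : (2*k+1) % 2 = 1 := by omega
    have h2 : (2*k+1) / 2 = k := by omega
    simp [SS, h2]
  have Spe : ∀ k v, SS r T (r+1) (2*k) v = T r k v ^ 2 := by
    intro k v; simp [SS]
  have Spo : ∀ m v, m % 2 = 1 → SS r T (r+1) m v = 0 := by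
    intro m v h; simp [SS, h]
  have ur : ∀ m v, m ≤ ℓ → IsUnit (T r m v) := by
    intro m v hm
    rcases Nat.eq_zero_or_pos m with h | h
    · subst h; rw [hm0 _ _ le_rfl]; exact isUnit_one
    rcases hm.eq_or_lt with h' | h'
    · subst h'; rw [hmℓ]; exact isUnit_one
    exact hunit2 m v h (by omega)
  have ua : ∀ a m v, a < r → m ≤ 2 * ℓ → IsUnit (T a m v) := by
    intro a m v ha hm
    rcases Nat.eq_zero_or_pos a with h | ha0
    · subst h; rw [h0]; exact isUnit_one
    rcases Nat.eq_zero_or_pos m with h | h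
    · subst h; rw [hm0 _ _ ha.le]; exact isUnit_one
    rcases hm.eq_or_lt with h' | h'
    · subst h'; rw [hm2ℓ _ _ ha0 (by omega)]; exact isUnit_one
    exact hunit1 a m v ha0 (by omega) h (by omega)
  have tl : ∀ a v, a < r → T a (2 * ℓ) v = 1 := by
    intro a v ha
    rcases Nat.eq_zero_or_pos a with h | ha0
    · subst h; exact h0 _ _
    · exact hm2ℓ _ _ ha0 (by omega)
  have par : ∀ m : ℕ, (∃ k, m = 2 * k) ∨ (∃ k, m = 2 * k + 1) := by
    intro m
    rcases Nat.mod_two_eq_zero_or_one m with h | h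
    · exact Or.inl ⟨m / 2, by omega⟩
    · exact Or.inr ⟨m / 2, by omega⟩
  have row1 : ∀ m v, m ≤ 2 * ℓ →
      T 1 m (v + (2 * ((r:ℤ) + 1) + (2 * ℓ : ℕ))) = T 1 (2 * ℓ - m) v := by
    intro m v hm
    rw [← Slt 1 m _ (by omega), ← Slt 1 _ v (by omega)]
    refine core r (2 * ℓ) (by omega) (by omega) (by omega) (SS r T) ?_ ?_ ?_ ?_ ?_ Spo ?_ ?_ m v hm
    · intro m v; rw [Slt _ _ _ (by omega), h0]
    · intro a v ha
      have hc : a < r ∨ a = r ∨ a = r + 1 := by omega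
      rcases hc with h | h | h
      · rw [Slt _ _ _ h, hm0 _ _ h.le]
      · have := Sre 0 v
        simp only [mul_zero] at this
        rw [h, this, hm0 _ _ le_rfl, hm0 _ _ le_rfl, one_mul]
      · have := Spe 0 v
        simp only [mul_zero] at this
        rw [h, this, hm0 _ _ le_rfl, one_pow]
    · intro a v ha
      have hc : a < r ∨ a = r ∨ a = r + 1 := by omega
      rcases hc with h | h | h
      · rw [Slt _ _ _ h, tl _ _ h]
      · rw [h, Sre, hmℓ, hmℓ, one_mul]
      · rw [h, Spe, hmℓ, one_pow]
    · intro a m v ha hm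
      rcases ha.lt_or_eq with h | h
      · rw [Slt _ _ _ h]; exact ua _ _ _ h hm
      · rw [h]
        rcases par m with ⟨k, rfl⟩ | ⟨k, rfl⟩
        · rw [Sre]; exact (ur _ _ (by omega)).mul (ur _ _ (by omega))
        · rw [Sro]; exact (ur _ _ (by omega)).mul (ur _ _ (by omega))
    · intro m v hm hm2
      obtain ⟨k, rfl⟩ : ∃ k, m = 2 * k := ⟨m / 2, by omega⟩
      rw [Spe]; exact (ur _ _ (by omega)).pow 2
    · intro a m v ha har hm
      have hc : a + 1 < r ∨ a + 1 = r ∨ a = r := by omega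
      rcases hc with h | h | h
      · rw [Slt a _ _ (by omega), Slt a _ _ (by omega), Slt a _ _ (by omega), Slt a _ _ (by omega),
          Slt (a-1) _ _ (by omega), Slt (a+1) _ _ (by omega)]
        have := hsysA a (m+1) v ha (by omega) (by omega) (by omega)
        simpa using this
      · rw [Slt a _ _ (by omega), Slt a _ _ (by omega), Slt a _ _ (by omega), Slt a _ _ (by omega),
          Slt (a-1) _ _ (by omega), h]
        obtain rfl : a = r - 1 := by omega
        rw [show r - 1 - 1 = r - 2 by omega]
        rcases par m with ⟨k, rfl⟩ | ⟨k, rfl⟩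
        · rw [Sro]
          exact hsysC k v (by omega)
        · rw [show 2 * k + 1 + 1 = 2 * (k + 1) by ring, Sre]
          have := hsysB (k+1) v (by omega) (by omega)
          rw [show 2 * (k + 1) - 1 = 2 * k + 1 by omega] at this
          rw [this, show 2 * k + 1 + 2 = 2 * (k + 1) + 1 by ring]
      · subst h
        rw [Slt (a-1) _ _ (by omega)]
        rcases par m with ⟨k, rfl⟩ | ⟨k, rfl⟩
        · rw [Sro, Sro, Sre, show 2 * k + 2 = 2 * (k + 1) by ring, Sre, Spo _ _ (by omega)]
          ring
        · rw [show 2 * k + 1 + 2 = 2 * (k + 1) + 1 by ring, show 2 * k + 1 + 1 = 2 * (k + 1) by ring,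
            Sre, Sre, Sro, Sro, Spe]
          have := hsysD (k+1) v (by omega) (by omega)
          simp only [Nat.add_sub_cancel] at this
          rw [show v - 1 - 1 = v - 2 by ring, show v + 1 + 1 = v + 2 by ring,
            show v - 1 + 1 = v by ring, show v + 1 - 1 = v by ring]
          linear_combination (T a (k+1) v ^ 2) * this
    · intro m v hm hm2
      obtain ⟨k, rfl⟩ : ∃ k, m = 2 * k := ⟨m / 2, by omega⟩
      rw [Sro, Spe, show 2 * k + 2 = 2 * (k + 1) by ring, Spe]
      ring
  have eK : ∀ v : ℤ, v + 2 * ((r : ℤ) + 1 + ℓ) = v + (2 * ((r:ℤ) + 1) + (2 * ℓ : ℕ)) := by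
    intro v; push_cast; ring
  obtain ⟨K, hK⟩ : ∃ K : ℤ, K = 2 * ((r : ℤ) + 1 + ℓ) := ⟨_, rfl⟩
  have row1' : ∀ m v, m ≤ 2 * ℓ → T 1 m (v + K) = T 1 (2 * ℓ - m) v := by
    intro m v hm; rw [hK, eK]; exact row1 m v hm
  have rows : ∀ a, a + 1 < r → (∀ m v, m ≤ 2 * ℓ → T a m (v + K) = T a (2 * ℓ - m) v) ∧
      (∀ m v, m ≤ 2 * ℓ → T (a+1) m (v + K) = T (a+1) (2 * ℓ - m) v) := by
    intro a
    induction a with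
    | zero =>
      intro _
      exact ⟨fun m v _ => by rw [h0, h0], row1'⟩
    | succ a ih =>
      intro ha
      obtain ⟨i1, i2⟩ := ih (by omega)
      refine ⟨i2, ?_⟩
      intro m v hm
      rcases Nat.eq_zero_or_pos m with h | h
      · subst h; rw [hm0 _ _ (by omega), Nat.sub_zero, tl _ _ (by omega)]
      rcases hm.eq_or_lt with h' | h'
      · subst h'; rw [tl _ _ (by omega), Nat.sub_self, hm0 _ _ (by omega)]
      have s1 := hsysA (a+1) m (v + K) (by omega) (by omega) (by omega) (by omega)
      have s2 := hsysA (a+1) (2 * ℓ - m) v (by omega) (by omega) (by omega) (by omega)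
      rw [show v + K - 1 = v - 1 + K by ring, show v + K + 1 = v + 1 + K by ring,
        i2 _ _ hm, i2 _ _ hm, i2 _ _ (by omega), i2 _ _ (by omega), s2] at s1
      rw [show 2 * ℓ - (m - 1) = 2 * ℓ - m + 1 by omega,
        show 2 * ℓ - (m + 1) = 2 * ℓ - m - 1 by omega] at s1
      simp only [Nat.add_sub_cancel] at s1
      rw [i1 _ _ hm] at s1
      apply (ua a (2 * ℓ - m) v (by omega) (by omega)).mul_left_cancel
      linear_combination -s1
  have rowsa : ∀ a m v, a < r → m ≤ 2 * ℓ → T a m (v + K) = T a (2 * ℓ - m) v := by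
    intro a m v ha hm
    rcases Nat.eq_zero_or_pos a with h | h
    · subst h; rw [h0, h0]
    · obtain ⟨b, rfl⟩ : ∃ b, a = b + 1 := ⟨a - 1, by omega⟩
      exact (rows b ha).2 m v hm
  have rowr : ∀ m v, m ≤ ℓ → T r m (v + K) = T r (ℓ - m) v := by
    intro m
    induction m with
    | zero => intro v _; rw [hm0 _ _ le_rfl, Nat.sub_zero, hmℓ]
    | succ m ih =>
      intro v hm
      have s1 := hsysC m (v + K) (by omega)
      have s2 := hsysC (ℓ - 1 - m) v (by omega)
      rw [show v + K - 1 = v - 1 + K by ring, show v + K + 1 = v + 1 + K by ring,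
        rowsa _ _ _ (by omega) (by omega), rowsa _ _ _ (by omega) (by omega),
        rowsa _ _ _ (by omega) (by omega), rowsa _ _ _ (by omega) (by omega),
        rowsa _ _ _ (by omega) (by omega), ih v (by omega)] at s1
      rw [show 2 * (ℓ - 1 - m) + 1 = 2 * ℓ - (2 * m + 1) by omega,
        show 2 * (ℓ - 1 - m) + 2 = 2 * ℓ - 2 * m by omega,
        show 2 * (ℓ - 1 - m) = 2 * ℓ - (2 * m + 2) by omega,
        show ℓ - 1 - m + 1 = ℓ - m by omega, show ℓ - 1 - m = ℓ - (m + 1) by omega] at s2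
      apply ((ua (r-2) (2 * ℓ - (2 * m + 1)) v (by omega) (by omega)).mul
        (ur (ℓ - m) v (by omega))).mul_left_cancel
      linear_combination s2 - s1
  have e4 : ∀ v : ℤ, v + 4 * ((r : ℤ) + 1 + ℓ) = v + K + K := by
    intro v; rw [hK]; ring
  simp only [e4, ← hK]
  refine ⟨?_, ?_, ?_, ?_⟩
  · intro a m v _ h2 _ h4
    exact rowsa a m v (by omega) (by omega)
  · intro m v _ h2
    exact rowr m v (by omega)
  · intro a m v _ h2 _ h4
    rw [rowsa a m _ (by omega) (by omega), rowsa a _ _ (by omega) (by omega)]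
    congr 1; omega
  · intro m v _ h2
    rw [rowr m _ (by omega), rowr _ _ (by omega)]
    congr 1; omega
end

section
/- Let R be a commutative ring, r ≥ 1, ℓ ≥ 1, and let (x_k)_{k ∈ ℤ} be a family of column vectors x_k ∈ R^{2ℓ} satisfying x_{k + 2r + 2 + 2ℓ} = x_k for all k ∈ ℤ. For (a,m,u) with 0 ≤ a ≤ 2r+2, 0 ≤ m ≤ 2ℓ, u ∈ (1/2)ℤ and a + m + 2u even, set β = −(a+m+2u)/2 and define D^{(a)}_m(u) ∈ R as the determinant of the 2ℓ×2ℓ matrix whose columns are x_β, x_{β+1}, …, x_{β+m−1}, x_{β+m+a}, x_{β+m+a+1}, …, x_{β+2ℓ+a−1}. Then: (1) for all 1 ≤ a ≤ 2r+1, 1 ≤ m ≤ 2ℓ−1 and u with a + m + 2u odd: D^{(a)}_m(u−1/2)·D^{(a)}_m(u+1/2) = D^{(a)}_{m−1}(u)·D^{(a)}_{m+1}(u) + D^{(a−1)}_m(u)·D^{(a+1)}_m(u); (2) boundary relations: D^{(a)}_0(u+1/2) = D^{(a−1)}_0(u) for 1 ≤ a ≤ 2r+2; D^{(a)}_{2ℓ}(u+1/2)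 = D^{(a+1)}_{2ℓ}(u) for 0 ≤ a ≤ 2r+1; D^{(0)}_m(u+1/2) = D^{(0)}_{m+1}(u) for 0 ≤ m ≤ 2ℓ−1; D^{(2r+2)}_m(u+1/2) = −D^{(2r+2)}_{m−1}(u) for 1 ≤ m ≤ 2ℓ (each whenever the parity conditions making both sides defined hold); (3) half-periodicity: D^{(a)}_m(u + r + 1 + ℓ) = (−1)^m D^{(2r+2−a)}_{2ℓ−m}(u) whenever a + m + 2u is even. -/
/-- Determinant of the matrix with columns `y 0, …, y (N-1)`. -/
def colDet {R : Type*} [CommRing R] (N : ℕ) (y : ℕ → Fin N → R) : R :=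
  Matrix.det (Matrix.of fun i j : Fin N => y (j : ℕ) i)

theorem colDet_congr {R : Type*} [CommRing R] {N : ℕ} {y z : ℕ → Fin N → R}
    (h : ∀ j, j < N → y j = z j) : colDet N y = colDet N z := by
  unfold colDet
  congr 1
  ext i j
  simp [h j j.2]

theorem colDet_swap {R : Type*} [CommRing R] {N : ℕ} (y z : ℕ → Fin N → R) (q : ℕ)
    (hq : q + 1 < N) (h0 : z q = y (q + 1)) (h1 : z (q + 1) = y q)
    (h : ∀ j, j ≠ q → j ≠ q + 1 → z j = y j) : colDet N z = - colDet N y := by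
  have hne : (⟨q, by omega⟩ : Fin N) ≠ ⟨q + 1, hq⟩ := by simp
  have := Matrix.det_permute' (Equiv.swap (⟨q, by omega⟩ : Fin N) ⟨q + 1, hq⟩)
    (Matrix.of fun i j : Fin N => y (j : ℕ) i)
  rw [Equiv.Perm.sign_swap hne] at this
  unfold colDet
  simp only [Units.val_neg, Units.val_one, Int.cast_neg, Int.cast_one, neg_mul, one_mul] at this
  rw [← this]
  congr 1
  ext i j
  simp only [Matrix.of_apply, Matrix.submatrix_apply, id]
  by_cases e0 : j = ⟨q, by omega⟩
  · subst e0; simp [h0]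
  by_cases e1 : j = ⟨q + 1, hq⟩
  · subst e1; simp [h1]
  rw [Equiv.swap_apply_of_ne_of_ne e0 e1, h]
  · intro e; exact e0 (Fin.ext e)
  · intro e; exact e1 (Fin.ext e)

theorem colDet_anti {R : Type*} [CommRing R] {N : ℕ} (y : ℕ → Fin N → R) (p q : ℕ)
    (hp : p < N) (hq : q < N) (hpq : p ≠ q) (u v : Fin N → R) :
    colDet N (fun j => if j = p then u else if j = q then v else y j) =
    - colDet N (fun j => if j = p then v else if j = q then u else y j) := by
  have hne : (⟨p, hp⟩ : Fin N) ≠ ⟨q, hq⟩ := by simpa using hpq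
  have := Matrix.det_permute' (Equiv.swap (⟨p, hp⟩ : Fin N) ⟨q, hq⟩)
    (Matrix.of fun i j : Fin N => (if (j : ℕ) = p then v else if (j : ℕ) = q then u else y j) i)
  rw [Equiv.Perm.sign_swap hne] at this
  unfold colDet
  simp only [Units.val_neg, Units.val_one, Int.cast_neg, Int.cast_one, neg_mul, one_mul] at this
  rw [← this]
  congr 1
  ext i j
  simp only [Matrix.of_apply, Matrix.submatrix_apply, id]
  by_cases e0 : j = ⟨p, hp⟩
  · subst e0; simp [hpq.symm]
  by_cases e1 : j = ⟨q, hq⟩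
  · subst e1; simp [hpq.symm]
  rw [Equiv.swap_apply_of_ne_of_ne e0 e1]
  have h0 : (j : ℕ) ≠ p := fun e => e0 (Fin.ext e)
  have h1 : (j : ℕ) ≠ q := fun e => e1 (Fin.ext e)
  simp [h0, h1]

theorem colDet_move {R : Type*} [CommRing R] {N : ℕ} (y : ℕ → Fin N → R) (p d : ℕ)
    (hq : p + d < N) :
    colDet N (fun j => if j < p then y j else if j < p + d then y (j + 1)
      else if j = p + d then y p else y j) = (-1) ^ d * colDet N y := by
  induction d with
  | zero =>
    rw [pow_zero, one_mul]
    apply colDet_congr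
    intro j _
    split_ifs <;> first | rfl | omega | skip
    congr 1; omega
  | succ d ih =>
    rw [pow_succ, mul_assoc, neg_one_mul, mul_neg, ← ih (by omega)]
    apply colDet_swap _ _ (p + d) (by omega)
    · simp [show ¬ p + d + 1 < p by omega, show p + d < p + (d + 1) by omega]
    · simp [show p + d + 1 = p + (d + 1) by omega]
    · intro j h0 h1
      split_ifs <;> first | rfl | omega

theorem colDet_rot {R : Type*} [CommRing R] {ℓ : ℕ} (hℓ : 1 ≤ ℓ)
    (y z : ℕ → Fin (2 * ℓ) → R)
    (h : ∀ j, j + 1 < 2 * ℓ → z j = y (j + 1)) (h' : z (2 * ℓ - 1) = y 0) :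
    colDet (2 * ℓ) z = - colDet (2 * ℓ) y := by
  have := colDet_move y 0 (2 * ℓ - 1) (by omega)
  rw [Odd.neg_one_pow ⟨ℓ - 1, by omega⟩, neg_one_mul] at this
  rw [← this]
  apply colDet_congr
  intro j hj
  by_cases e : j + 1 < 2 * ℓ
  · rw [h j e]; simp [show j < 2 * ℓ - 1 by omega]
  · obtain rfl : j = 2 * ℓ - 1 := by omega
    rw [h']; simp

theorem colDet_rots {R : Type*} [CommRing R] {ℓ : ℕ} (hℓ : 1 ≤ ℓ)
    (y z : ℕ → Fin (2 * ℓ) → R) (m : ℕ) (hm : m ≤ 2 * ℓ)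
    (h : ∀ j, j + m < 2 * ℓ → z j = y (j + m))
    (h' : ∀ j, j < m → z (j + (2 * ℓ - m)) = y j) :
    colDet (2 * ℓ) z = (-1) ^ m * colDet (2 * ℓ) y := by
  induction m generalizing z with
  | zero =>
    rw [pow_zero, one_mul]
    apply colDet_congr
    intro j hj; exact h j hj
  | succ m ih =>
    rw [pow_succ, mul_assoc, neg_one_mul, mul_neg,
      ← ih (fun j => if j + m < 2 * ℓ then y (j + m) else y (j + m - 2 * ℓ)) (by omega)
        (by intro j hj; simp [hj])
        (by
          intro j hj
          have e : ¬ (j + (2 * ℓ - m) + m < 2 * ℓ) := by omega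
          simp only [if_neg e]
          congr 1; omega)]
    apply colDet_rot hℓ
    · intro j hj
      split_ifs with c
      · rw [h j (by omega)]; congr 1; omega
      · rw [← h' (j + 1 + m - 2 * ℓ) (by omega)]; congr 1; omega
    · rw [if_pos (by omega)]
      have := h' m (by omega)
      rw [zero_add, ← this]; congr 1; omega

theorem colDet_rep {R : Type*} [CommRing R] {N : ℕ} (y : ℕ → Fin N → R) (p q : Fin N)
    (hpq : p ≠ q) (A b C E : Fin N → R) :
    let f : (Fin N → R) → (Fin N → R) → R := fun u v =>
      colDet N (fun j => if j = p then u else if j = q then v else y j)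
    f A C * f b E = f E C * f b A + f A E * f b C := by
  intro f
  have hf : ∀ u v, f u v = Matrix.det (((Matrix.of fun i j : Fin N => y (j : ℕ) i).updateCol
      p u).updateCol q v) := by
    intro u v
    simp only [f, colDet]
    congr 1
    ext i j
    simp only [Matrix.of_apply, Matrix.updateCol_apply, Fin.ext_iff]
    have : (p : ℕ) ≠ q := fun e => hpq (Fin.ext e)
    split_ifs <;> first | rfl | omega
  set M := Matrix.of fun i j : Fin N => y (j : ℕ) i with hM
  set T := (M.updateCol p A).updateCol q C with hT
  set S := M.updateCol p b with hS
  have key := Matrix.mulVec_cramer T E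
  have hs : T.mulVec (Matrix.cramer T E) =
      ∑ c, Matrix.cramer T E c • (fun i => T i c) := by
    ext i
    simp [Matrix.mulVec, dotProduct, mul_comm]
  rw [hs] at key
  have hlin := congrArg (fun w => Matrix.cramer S w q) key
  simp only [map_sum, map_smul, Finset.sum_apply, Pi.smul_apply, smul_eq_mul] at hlin
  simp only [Matrix.cramer_apply] at hlin
  rw [hf A C, hf b E, hf E C, hf b A, hf A E, hf b C, ← hT, ← hS, ← hlin,
    Fintype.sum_eq_add p q hpq]
  · congr 1
    · congr 2
      · rw [hT]
        ext i j
        simp only [Matrix.updateCol_apply]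
        split_ifs <;> simp_all
      · congr 1
        ext i
        simp [hT, hpq]
    · congr 2
      · rw [hT]
        simp
      · congr 1
        ext i
        simp [hT]
  · rintro i ⟨h1, h2⟩
    have : (S.updateCol q (fun k => T k i)).det = 0 := by
      apply Matrix.det_zero_of_column_eq h2
      intro k
      simp [hT, hS, h1, h2, Matrix.updateCol_apply]
    rw [this, mul_zero]


/-- The minors `D^{(a)}_m(u)` of a `2ℓ×∞` matrix whose columns satisfy the
periodicity `x_{k+2r+2+2ℓ} = x_k` satisfy the T-system of type `A_{2r+1}`, the
boundary relations, and the half-periodicity.  The half-integer spectral parameter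
`u ∈ (1/2)ℤ` is encoded by the integer `v = 2u` (so `a+m+2u = a+m+v` and a shift of
`u` by `1/2` is a shift of `v` by `1`).  Here `D^{(a)}_m(v)` (for `a+m+v` even,
`β = −(a+m+v)/2`) is the determinant of the matrix with columns
`x_β, …, x_{β+m−1}, x_{β+m+a}, …, x_{β+2ℓ+a−1}`. -/
theorem determinant_solution_A2r1 {R : Type*} [CommRing R]
    (r ℓ : ℕ) (hr : 1 ≤ r) (hℓ : 1 ≤ ℓ)
    (x : ℤ → Fin (2 * ℓ) → R)
    (hx : ∀ k : ℤ, x (k + (2 * (r : ℤ) + 2 + 2 * ℓ)) = x k)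
    (D : ℕ → ℕ → ℤ → R)
    (hD : ∀ (a m : ℕ) (v β : ℤ), a ≤ 2 * r + 2 → m ≤ 2 * ℓ →
      (a : ℤ) + m + v = -(2 * β) →
      D a m v = Matrix.det (Matrix.of fun i j : Fin (2 * ℓ) =>
        x (β + if (j : ℕ) < m then ((j : ℕ) : ℤ) else ((a : ℤ) + (j : ℕ))) i)) :
    (∀ (a m : ℕ) (v : ℤ), 1 ≤ a → a ≤ 2 * r + 1 → 1 ≤ m → m ≤ 2 * ℓ - 1 →
      Odd ((a : ℤ) + m + v) →
      D a m (v - 1) * D a m (v + 1)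
        = D a (m - 1) v * D a (m + 1) v + D (a - 1) m v * D (a + 1) m v) ∧
    (∀ (a : ℕ) (v : ℤ), 1 ≤ a → a ≤ 2 * r + 2 → Odd ((a : ℤ) + v) →
      D a 0 (v + 1) = D (a - 1) 0 v) ∧
    (∀ (a : ℕ) (v : ℤ), a ≤ 2 * r + 1 → Odd ((a : ℤ) + 2 * ℓ + v) →
      D a (2 * ℓ) (v + 1) = D (a + 1) (2 * ℓ) v) ∧
    (∀ (m : ℕ) (v : ℤ), m ≤ 2 * ℓ - 1 → Odd ((m : ℤ) + v) →
      D 0 m (v + 1) = D 0 (m + 1) v) ∧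
    (∀ (m : ℕ) (v : ℤ), 1 ≤ m → m ≤ 2 * ℓ → Odd ((m : ℤ) + v) →
      D (2 * r + 2) m (v + 1) = -D (2 * r + 2) (m - 1) v) ∧
    (∀ (a m : ℕ) (v : ℤ), a ≤ 2 * r + 2 → m ≤ 2 * ℓ → Even ((a : ℤ) + m + v) →
      D a m (v + 2 * ((r : ℤ) + 1 + ℓ)) = (-1) ^ m * D (2 * r + 2 - a) (2 * ℓ - m) v) := by
  have hD' : ∀ (a m : ℕ) (v β : ℤ), a ≤ 2 * r + 2 → m ≤ 2 * ℓ →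
      (a : ℤ) + m + v = -(2 * β) →
      D a m v = colDet (2 * ℓ) (fun j => x (β + if j < m then (j : ℤ) else (a : ℤ) + j)) :=
    fun a m v β h1 h2 h3 => hD a m v β h1 h2 h3
  have hx' : ∀ k l : ℤ, k = l + (2 * (r : ℤ) + 2 + 2 * ℓ) → x k = x l := by
    rintro k l rfl; exact hx l
  have hxx : ∀ k l : ℤ, k = l → x k = x l := by
    rintro k l rfl; rfl
  refine ⟨?_, ?_, ?_, ?_, ?_, ?_⟩
  · rintro a m v ha1 ha2 hm1 hm2 ⟨k, hk⟩
    obtain ⟨a, rfl⟩ : ∃ a', a = a' + 1 := ⟨a - 1, by omega⟩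
    obtain ⟨m, rfl⟩ : ∃ m', m = m' + 1 := ⟨m - 1, by omega⟩
    simp only [Nat.add_sub_cancel]
    push_cast at hk
    -- columns A P b C Q E
    set B : ℤ := -k - 1 with hB
    set y : ℕ → Fin (2 * ℓ) → R :=
      fun j => if j ≤ m then x (B + j) else x (B + a + 1 + j) with hy
    have key := colDet_rep y ⟨0, by omega⟩ ⟨m + 1, by omega⟩ (by simp)
      (x B) (x (B + (m + 1))) (x (B + (m + 1) + (a + 1))) (x (B + 2 * ℓ + (a + 1)))
    simp only at key
    set f : (Fin (2 * ℓ) → R) → (Fin (2 * ℓ) → R) → R := fun u v =>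
      colDet (2 * ℓ) (fun j => if j = 0 then u else if j = m + 1 then v else y j) with hf
    set cA := x B with hA
    set cb := x (B + (m + 1)) with hb
    set cC := x (B + (m + 1) + (a + 1)) with hC
    set cE := x (B + 2 * ℓ + (a + 1)) with hE
    change f cA cC * f cb cE = f cE cC * f cb cA + f cA cE * f cb cC at key
    have hanti : f cb cA = - f cA cb := 
      colDet_anti y 0 (m + 1) (by omega) (by omega) (by omega) _ _
    have e1 : D (a + 1) (m + 1) (v - 1) = - f cE cb := by
      rw [hD' _ _ _ (B + 1) (by omega) (by omega) (by push_cast; omega)]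
      apply colDet_rot hℓ
      · intro j hj
        simp only [hy]
        split_ifs <;> first | omega | contradiction | exact hxx _ _ (by omega)
      · simp only [hE]
        split_ifs <;> first | omega | contradiction | exact hxx _ _ (by omega)
    have e2 : D (a + 1) (m + 1) (v + 1) = f cA cC := by
      rw [hD' _ _ _ B (by omega) (by omega) (by push_cast; omega)]
      apply colDet_congr
      intro j hj
      simp only [hy]
      split_ifs <;> first | omega | contradiction | exact hxx _ _ (by omega)
    have e3 : D (a + 1) m v = - f cE cC := by
      rw [hD' _ _ _ (B + 1) (by omega) (by omega) (by push_cast; omega)]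
      apply colDet_rot hℓ
      · intro j hj
        simp only [hy]
        split_ifs <;> first | omega | contradiction | exact hxx _ _ (by omega)
      · simp only [hE]
        split_ifs <;> first | omega | contradiction | exact hxx _ _ (by omega)
    have e4 : D (a + 1) (m + 1 + 1) v = f cA cb := by
      rw [hD' _ _ _ B (by omega) (by omega) (by push_cast; omega)]
      apply colDet_congr
      intro j hj
      simp only [hy]
      split_ifs <;> first | omega | contradiction | exact hxx _ _ (by omega)
    have e5 : D a (m + 1) v = (-1) ^ m * f cb cC := by
      rw [hD' _ _ _ (B + 1) (by omega) (by omega) (by push_cast; omega), hf]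
      simp only
      rw [← colDet_move _ 0 m (by omega)]
      apply colDet_congr
      intro j hj
      simp only [hy]
      split_ifs <;> first | omega | contradiction | exact hxx _ _ (by omega)
    have e6 : D (a + 1 + 1) (m + 1) v = (-1) ^ (2 * ℓ - 2 - m) * f cA cE := by
      rw [hD' _ _ _ B (by omega) (by omega) (by push_cast; omega), hf]
      simp only
      rw [← colDet_move _ (m + 1) (2 * ℓ - 2 - m) (by omega)]
      apply colDet_congr
      intro j hj
      simp only [hy]
      split_ifs <;> first | omega | contradiction | exact hxx _ _ (by omega)
    have hs : ((-1 : R)) ^ m * (-1) ^ (2 * ℓ - 2 - m) = 1 := by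
      rw [← pow_add, Even.neg_one_pow ⟨ℓ - 1, by omega⟩]
    have hanti2 : f cE cb = - f cb cE := 
      colDet_anti y 0 (m + 1) (by omega) (by omega) (by omega) _ _
    rw [e1, e2, e3, e4, e5, e6, hanti2]
    rw [hanti] at key
    linear_combination key - f cb cC * f cA cE * hs
  · rintro a v ha1 ha2 ⟨k, hk⟩
    rw [hD' a 0 (v + 1) (-k - 1) (by omega) (by omega) (by push_cast; omega),
      hD' (a - 1) 0 v (-k) (by omega) (by omega) (by push_cast; omega)]
    apply colDet_congr
    intro j hj
    simp only [Nat.not_lt_zero, if_false]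
    congr 1; omega
  · rintro a v ha ⟨k, hk⟩
    rw [hD' a (2 * ℓ) (v + 1) (-k - 1) (by omega) (by omega) (by push_cast; omega),
      hD' (a + 1) (2 * ℓ) v (-k - 1) (by omega) (by omega) (by push_cast; omega)]
    apply colDet_congr
    intro j hj
    simp only [hj, if_true]
  · rintro m v hm ⟨k, hk⟩
    rw [hD' 0 m (v + 1) (-k - 1) (by omega) (by omega) (by push_cast; omega),
      hD' 0 (m + 1) v (-k - 1) (by omega) (by omega) (by push_cast; omega)]
    apply colDet_congr
    intro j hj
    simp
  · rintro m v hm1 hm2 ⟨k, hk⟩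
    rw [hD' (2 * r + 2) m (v + 1) (-k - r - 2) (by omega) (by omega) (by push_cast; omega),
      hD' (2 * r + 2) (m - 1) v (-k - r - 1) (by omega) (by omega) (by push_cast; omega),
      eq_neg_iff_add_eq_zero, ← neg_eq_iff_add_eq_zero]
    symm
    apply colDet_rot hℓ
    · intro j hj
      split_ifs <;> first | omega | contradiction | exact hxx _ _ (by omega)
    · split_ifs <;> first | omega | (apply hx'; push_cast; omega)
  · rintro a m v ha hm ⟨k, hk⟩
    rw [hD' a m _ (-k - r - 1 - ℓ) (by omega) (by omega) (by push_cast; omega),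
      hD' (2 * r + 2 - a) (2 * ℓ - m) v (-k + a + m - r - 1 - ℓ) (by omega) (by omega)
        (by push_cast [Nat.cast_sub ha, Nat.cast_sub hm]; omega)]
    rw [colDet_rots hℓ (fun j => x (-k - r - 1 - ℓ + if j < m then (j : ℤ) else (a : ℤ) + j)) (fun j => x (-k + a + m - r - 1 - ℓ + if j < 2 * ℓ - m then (j : ℤ) else ((2 * r + 2 - a : ℕ) : ℤ) + j)) m hm]
    · rw [← mul_assoc, ← mul_pow]; simp
    · intro j hj
      split_ifs <;> first | omega | contradiction | exact hxx _ _ (by omega)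
    · intro j hj
      split_ifs <;> first | omega | (apply hx'; push_cast; omega)
end

section
/- Let R be a commutative ring, r ≥ 1, and let T = {T^{(a)}_1(u)} be a regular solution in R of the level 2 restricted T-system 𝕋_2(A_r): invertible elements T^{(a)}_1(u) ∈ R^× for 1 ≤ a ≤ r and u ∈ ℤ with a + u odd, satisfying T^{(a)}_1(u−1)·T^{(a)}_1(u+1) = 1 + T^{(a−1)}_1(u)·T^{(a+1)}_1(u) for all a, u with a + u even, where T^{(0)}_1(u) = T^{(r+1)}_1(u) = 1. Set x_a := T^{(a)}_1(a−1) for 1 ≤ a ≤ r. Then T^{(a)}_1(u) = τ^{(a)}(u) for all a, u with a + u odd, where τ^{(a)}(u) is the explicit expression in the initial variables x_1, …, x_r defined in the context. -/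
lemma antiper_ext {R : Type*} [CommRing R] (N : ℤ) (hN : 0 < N) (f : ℤ → R) :
    ∃ g : ℤ → R, (∀ n, g (n + N) = - g n) ∧ ∀ m, -1 ≤ m → m < N - 1 → g m = f m := by
  refine ⟨fun n => (((-1 : Rˣ) ^ ((n + 1) / N) : Rˣ) : R) * f ((n + 1) % N - 1), ?_, ?_⟩
  · intro n
    have h1 : (n + N + 1) / N = (n + 1) / N + 1 := by
      rw [show n + N + 1 = (n + 1) + N by ring, Int.add_ediv_of_dvd_right (dvd_refl N),
        Int.ediv_self hN.ne']
    have h2 : (n + N + 1) % N = (n + 1) % N := by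
      rw [show n + N + 1 = (n + 1) + N by ring, Int.add_emod_right]
    simp only [h1, h2, zpow_add, zpow_one]
    push_cast
    ring
  · intro m h1 h2
    have e1 : (m + 1) / N = 0 := Int.ediv_eq_zero_of_lt (by omega) (by omega)
    have e2 : (m + 1) % N = m + 1 := Int.emod_eq_of_lt (by omega) (by omega)
    simp [e1, e2]

lemma per_ind (N : ℤ) (hN : 0 < N) (p : ℤ → Prop) (hp : ∀ n, p (n + N) ↔ p n)
    (c : ℤ) (h0 : ∀ m, c ≤ m → m < c + N → p m) (n : ℤ) : p n := by
  have key : ∀ (q : ℤ) (m : ℤ), p (m + N * q) ↔ p m := by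
    intro q
    induction q using Int.induction_on with
    | zero => intro m; simp
    | succ i ih =>
      intro m
      rw [← ih m, ← hp (m + N * i)]
      ring_nf
    | pred i ih =>
      intro m
      rw [← ih m, ← hp (m + N * (-i - 1))]
      ring_nf
  have h1 := Int.emod_add_mul_ediv (n - c) N
  have h2 := Int.emod_nonneg (n - c) hN.ne'
  have h3 := Int.emod_lt_of_pos (n - c) hN
  have h4 := (key ((n - c) / N) (c + (n - c) % N)).2 (h0 _ (by omega) (by omega))
  have h5 : c + (n - c) % N + N * ((n - c) / N) = n := by omega
  rwa [h5] at h4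

lemma sum_Icc_diff {R : Type*} [CommRing R] (f : ℤ → R) (n : ℤ) (hn : 0 ≤ n) (j : ℤ) (hj : n ≤ j) :
    ∑ k ∈ Finset.Icc n (j - 1), f k
      = ∑ k ∈ Finset.Icc 0 (j - 1), f k - ∑ k ∈ Finset.Icc 0 (n - 1), f k := by
  have h : Finset.Icc 0 (j - 1) = Finset.Icc 0 (n - 1) ∪ Finset.Icc n (j - 1) := by
    ext k; simp only [Finset.mem_union, Finset.mem_Icc]; omega
  have hd : Disjoint (Finset.Icc 0 (n - 1)) (Finset.Icc n (j - 1)) := by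
    rw [Finset.disjoint_left]; intro k; simp only [Finset.mem_Icc]; omega
  rw [h, Finset.sum_union hd]; ring

/-- Every regular solution `T` of the level 2 restricted T-system `𝕋_2(A_r)` is given
by the explicit formula `T^{(a)}_1(u) = τ^{(a)}(u)` in the initial variables
`x_a = T^{(a)}_1(a−1)`. -/
theorem T2Ar_explicit_formula {R : Type*} [CommRing R] (r : ℤ) (hr : 1 ≤ r)
    (T : ℤ → ℤ → R)
    (hTunit : ∀ a u, 1 ≤ a → a ≤ r → Odd (a + u) → IsUnit (T a u))
    (hTsys : ∀ a u, 1 ≤ a → a ≤ r → Even (a + u) →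
      T a (u - 1) * T a (u + 1)
        = 1 + (if a = 1 then 1 else T (a - 1) u) * (if a = r then 1 else T (a + 1) u))
    (x : ℤ → R) (hx0 : x 0 = 1) (hxm1 : x (-1) = 0)
    (hxdef : ∀ a, 1 ≤ a → a ≤ r → x a = T a (a - 1))
    (γ ν : ℤ → ℤ → R)
    (hγ : ∀ j n, 1 ≤ j → j ≤ r → 0 ≤ n → n ≤ j - 1 →
      γ j n = Ring.inverse (x n)
        + ∑ k ∈ Finset.Icc n (j - 2),
            x (n - 1) * Ring.inverse (x k) * Ring.inverse (x (k + 1)))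
    (hγtop : ∀ j, 1 ≤ j → j ≤ r → γ j j = 0)
    (hν : ∀ j n, 1 ≤ j → j ≤ r → 0 ≤ n → n ≤ j →
      ν j n = x (n - 1) * Ring.inverse (x (j - 1)))
    (τ : ℤ → ℤ → R)
    (hτ1 : ∀ a k, 1 ≤ a → a ≤ r → 0 ≤ k → k ≤ r - a →
      τ a (a - 1 + 2 * k) = γ (a + k) k * x (a + k) + ν (a + k) k)
    (hτ2 : ∀ a, 1 ≤ a → a ≤ r →
      τ a (a - 1 + 2 * (r - a + 1))
        = γ r (r + 1 - a) + ν r (r + 1 - a) * (1 + x (r - 1)) * Ring.inverse (x r))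
    (hτ3 : ∀ a k, 1 ≤ a → a ≤ r → r - a + 2 ≤ k → k ≤ r + 1 →
      τ a (a - 1 + 2 * k)
        = γ (k - 1) (a + k - (r + 2)) * x (k - 1) + ν (k - 1) (a + k - (r + 2)))
    (hτ4 : ∀ a, 1 ≤ a → a ≤ r →
      τ a (a - 1 + 2 * (r + 2))
        = γ r a + ν r a * (1 + x (r - 1)) * Ring.inverse (x r))
    (hτper : ∀ a u, 1 ≤ a → a ≤ r → τ a (u + 2 * (r + 3)) = τ a u) :
    ∀ a u, 1 ≤ a → a ≤ r → Odd (a + u) → T a u = τ a u := by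
  set i : ℤ → R := fun n => Ring.inverse (x n) with hi
  have hxi : ∀ n, 0 ≤ n → n ≤ r → x n * i n = 1 := by
    intro n h0 h1
    apply Ring.mul_inverse_cancel
    rcases eq_or_lt_of_le h0 with h | h
    · rw [← h, hx0]; exact isUnit_one
    · rw [hxdef n (by omega) h1]
      exact hTunit _ _ (by omega) h1 ⟨n - 1, by ring⟩
  have hi0 : i 0 = 1 := by simp [hi, hx0]
  set S : ℤ → R := fun j => ∑ k ∈ Finset.Icc 0 (j - 1), i k * i (k + 1) with hS
  have hdiff : ∀ n j, 0 ≤ n → n ≤ j → ∑ k ∈ Finset.Icc n (j - 1), i k * i (k + 1) = S j - S n := by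
    intro n j h0 h1
    exact sum_Icc_diff (fun k => i k * i (k + 1)) n h0 j h1
  have hSs : ∀ j, 0 ≤ j → S (j + 1) = S j + i j * i (j + 1) := by
    intro j hj
    have := hdiff j (j + 1) hj (by omega)
    rw [show j + 1 - 1 = j by ring, Finset.Icc_self, Finset.sum_singleton] at this
    rw [this]; ring
  have hS0 : S 0 = 0 := by simp [hS]
  clear_value S
  obtain ⟨P, hPa, hP⟩ := antiper_ext (r + 3) (by omega)
    (fun j => if j = r + 1 then 1 else x j)
  obtain ⟨Q, hQa, hQ⟩ := antiper_ext (r + 3) (by omega)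
    (fun j => if j = -1 then -1 else if j = r + 1 then S r + i r else x j * S j)
  have hPm : P (-1) = 0 := by
    rw [hP _ (by omega) (by omega), if_neg (by omega), hxm1]
  have hQm : Q (-1) = -1 := by
    rw [hQ _ (by omega) (by omega), if_pos rfl]
  have hPr : P (r + 1) = 1 := by
    rw [hP _ (by omega) (by omega), if_pos rfl]
  have hQr : Q (r + 1) = S r + i r := by
    rw [hQ _ (by omega) (by omega), if_neg (by omega), if_pos rfl]
  have hPj : ∀ j, 0 ≤ j → j ≤ r → P j = x j := by
    intro j h0 h1
    rw [hP _ (by omega) (by omega), if_neg (by omega)]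
  have hQj : ∀ j, 0 ≤ j → j ≤ r → Q j = x j * S j := by
    intro j h0 h1
    rw [hQ _ (by omega) (by omega), if_neg (by omega), if_neg (by omega)]
  have hdet : ∀ n, P n * Q (n + 1) - Q n * P (n + 1) = 1 := by
    refine per_ind (r + 3) (by omega)
      (fun n => P n * Q (n + 1) - Q n * P (n + 1) = 1) ?_ (-1) ?_
    rotate_left
    · intro m h0 h1
      beta_reduce
      rcases eq_or_lt_of_le h0 with h | h
      · rw [← h, hPm, hQm, show (-1 : ℤ) + 1 = 0 by ring, hPj 0 le_rfl (by omega), hx0]; ring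
      rcases lt_trichotomy m r with h2 | h2 | h2
      · rw [hPj m (by omega) (by omega), hQj m (by omega) (by omega),
          hPj (m + 1) (by omega) (by omega), hQj (m + 1) (by omega) (by omega),
          hSs m (by omega)]
        linear_combination (x (m + 1) * i (m + 1)) * hxi m (by omega) (by omega)
          + hxi (m + 1) (by omega) (by omega)
      · rw [h2, hPr, hQr, hPj r (by omega) le_rfl, hQj r (by omega) le_rfl]
        linear_combination hxi r (by omega) le_rfl
      · have : m = r + 1 := by omega
        rw [this, show r + 1 + 1 = -1 + (r + 3) by ring, hPa, hQa, hPr, hPm, hQm]; ring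
    · intro n
      beta_reduce
      rw [show n + (r + 3) + 1 = (n + 1) + (r + 3) by ring, hPa, hPa, hQa, hQa]
      ring_nf
  set D : ℤ → ℤ → R := fun k j => P (k - 1) * Q j - Q (k - 1) * P j with hD
  have hD0 : ∀ k, D k k = 1 := by
    intro k
    have := hdet (k - 1)
    rw [sub_add_cancel] at this
    exact this
  have hDglide : ∀ k j, D k (j + (r + 2)) = D j (k - 1) := by
    intro k j
    simp only [hD]
    rw [show j + (r + 2) = (j - 1) + (r + 3) by ring, hPa, hQa]; ring
  have hDr : ∀ k, D k (k + r + 1) = 1 := by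
    intro k
    rw [show k + r + 1 = (k - 1) + (r + 2) by ring, hDglide, hD0]
  have hDrec : ∀ k j, D k j * D (k + 1) (j + 1) = 1 + D (k + 1) j * D k (j + 1) := by
    intro k j
    have h1 := hdet (k - 1)
    have h2 := hdet j
    rw [sub_add_cancel] at h1
    simp only [hD, add_sub_cancel_right]
    linear_combination (P j * Q (j + 1) - Q j * P (j + 1)) * h1 + h2
  have hDx : ∀ j, 0 ≤ j → j ≤ r → D 0 j = x j := by
    intro j h0 h1
    simp only [hD, zero_sub, hPm, hQm, hPj j h0 h1]; ring
  have hD1 : ∀ n j, 1 ≤ n → n ≤ r → 0 ≤ j → j ≤ r →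
      D n j = x (n - 1) * x j * (S j - S (n - 1)) := by
    intro n j h0 h1 h2 h3
    simp only [hD]
    rw [hPj (n - 1) (by omega) (by omega), hQj (n - 1) (by omega) (by omega), hPj j h2 h3, hQj j h2 h3]; ring
  have hD2 : ∀ n, 1 ≤ n → n ≤ r →
      D n (r + 1) = x (n - 1) * (S r + i r - S (n - 1)) := by
    intro n h0 h1
    simp only [hD]
    rw [hPj (n - 1) (by omega) (by omega), hQj (n - 1) (by omega) (by omega), hPr, hQr]; ring
  clear_value D
  -- T agrees with D
  have hTD : ∀ k a, 1 ≤ a → a ≤ r → T a (a - 1 + 2 * k) = D k (a + k) := by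
    intro k
    induction k using Int.induction_on with
    | zero =>
      intro a h0 h1
      rw [mul_zero, add_zero, add_zero, hDx a (by omega) h1, hxdef a h0 h1]
    | succ k ih =>
      generalize (k : ℤ) = k at ih ⊢
      intro a h0
      induction a, h0 using Int.le_induction with
      | base =>
        intro h1
        have hs := hTsys 1 (1 + 2 * k) le_rfl h1 ⟨1 + k, by ring⟩
        have hu := hTunit 1 (1 - 1 + 2 * k) le_rfl h1 ⟨k, by ring⟩
        apply hu.mul_left_cancel
        rw [if_pos rfl, show (1 : ℤ) + 2 * k - 1 = 1 - 1 + 2 * k by ring,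
          show (1 : ℤ) + 2 * k + 1 = 1 - 1 + 2 * (k + 1) by ring] at hs
        rw [hs, ih 1 le_rfl h1]
        have hrec := hDrec k (1 + k)
        rw [show (1 : ℤ) + (k + 1) = 1 + k + 1 by ring, hrec, add_comm (1 : ℤ) k, hD0]
        split_ifs with h
        · subst h; rw [hDr]
        · have := ih (1 + 1) (by omega) (by omega)
          rw [show (1 : ℤ) + 1 - 1 + 2 * k = 1 + 2 * k by ring] at this
          rw [this]; ring_nf
      | succ a ha iha =>
        intro h1
        have iha := iha (by omega)
        have hs := hTsys (a + 1) (a + 1 + 2 * k) (by omega) h1 ⟨a + 1 + k, by ring⟩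
        have hu := hTunit (a + 1) (a + 1 - 1 + 2 * k) (by omega) h1 ⟨a + k, by ring⟩
        apply hu.mul_left_cancel
        rw [if_neg (by omega), show a + 1 + 2 * k - 1 = a + 1 - 1 + 2 * k by ring,
          show a + 1 + 2 * k + 1 = a + 1 - 1 + 2 * (k + 1) by ring,
          show a + 1 + 2 * k = a - 1 + 2 * (k + 1) by ring, show a + 1 - 1 = a by ring, iha] at hs
        rw [show a + 1 - 1 = a by ring, hs]
        have e := ih (a + 1) (by omega) h1
        rw [show a + 1 - 1 = a by ring] at e
        rw [e]
        have hrec := hDrec k (a + 1 + k)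
        rw [show a + 1 + (k + 1) = a + 1 + k + 1 by ring, hrec,
          show a + (k + 1) = a + 1 + k by ring]
        split_ifs with h
        · subst h; rw [show a + 1 + k + 1 = k + (a + 1) + 1 by ring, hDr]
        · have := ih (a + 1 + 1) (by omega) (by omega)
          rw [show a + 1 + 1 - 1 + 2 * k = a - 1 + 2 * (k + 1) by ring] at this
          rw [this]; ring_nf
    | pred k ih =>
      generalize (-(k : ℤ)) = l at ih ⊢
      obtain ⟨k, rfl⟩ : ∃ k, l = k + 1 := ⟨l - 1, by ring⟩
      rw [add_sub_cancel_right]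
      suffices H : ∀ b, 0 ≤ b → ∀ a, a = r - b → 1 ≤ a → T a (a - 1 + 2 * k) = D k (a + k) by
        intro a h0 h1
        exact H (r - a) (by omega) a (by ring) h0
      intro b hb
      induction b, hb using Int.le_induction with
      | base =>
        rintro a hab h0
        obtain rfl : a = r := by omega
        have hs := hTsys a (a + 2 * k) h0 le_rfl ⟨a + k, by ring⟩
        have hu := hTunit a (a - 1 + 2 * (k + 1)) h0 le_rfl ⟨a + k, by ring⟩
        apply hu.mul_right_cancel
        rw [if_pos (rfl : a = a), show a + 2 * k - 1 = a - 1 + 2 * k by ring,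
          show a + 2 * k + 1 = a - 1 + 2 * (k + 1) by ring] at hs
        rw [hs, ih a h0 le_rfl]
        have hrec := hDrec k (a + k)
        rw [show a + (k + 1) = a + k + 1 by ring, hrec, add_comm a k, hDr]
        split_ifs with h
        · rw [h, hD0]
        · have := ih (a - 1) (by omega) (by omega)
          rw [show a - 1 - 1 + 2 * (k + 1) = a + 2 * k by ring] at this
          rw [this]; ring_nf
      | succ b hb ihb =>
        rintro a hab h0
        have ihb := ihb (a + 1) (by omega) (by omega)
        have h1 : a ≤ r := by omega
        have hs := hTsys a (a + 2 * k) h0 h1 ⟨a + k, by ring⟩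
        have hu := hTunit a (a - 1 + 2 * (k + 1)) h0 h1 ⟨a + k, by ring⟩
        apply hu.mul_right_cancel
        rw [add_sub_cancel_right] at ihb
        rw [if_neg (by omega : ¬ a = r), ihb, show a + 2 * k - 1 = a - 1 + 2 * k by ring,
          show a + 2 * k + 1 = a - 1 + 2 * (k + 1) by ring] at hs
        rw [hs, ih a h0 h1]
        have hrec := hDrec k (a + k)
        rw [show a + (k + 1) = a + k + 1 by ring, hrec, show a + 1 + k = a + k + 1 by ring]
        split_ifs with h
        · rw [h, add_comm 1 k, hD0]
        · have := ih (a - 1) (by omega) (by omega)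
          rw [show a - 1 - 1 + 2 * (k + 1) = a + 2 * k by ring] at this
          rw [this]; ring_nf
  -- closed formulas
  have hγ' : ∀ j n, 1 ≤ j → j ≤ r → 0 ≤ n → n ≤ j - 1 →
      γ j n = i n + x (n - 1) * (S (j - 1) - S n) := by
    intro j n h0 h1 h2 h3
    rw [hγ j n h0 h1 h2 h3, ← hdiff n (j - 1) h2 h3, Finset.mul_sum,
      show j - 1 - 1 = j - 2 by ring]
    congr 1
    exact Finset.sum_congr rfl fun k _ => by rw [mul_assoc]
  have hA : ∀ j n, j ≤ r → 0 ≤ n → n < j → γ j n * x j + ν j n = D n j := by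
    intro j n h1 h2 h3
    have hνe : ν j n = x (n - 1) * i (j - 1) := hν j n (by omega) h1 h2 (by omega)
    rw [hγ' j n (by omega) h1 h2 (by omega), hνe]
    rcases eq_or_lt_of_le h2 with h | h
    · rw [← h, hDx j (by omega) h1, zero_sub, hxm1, hi0]; ring
    · rw [hD1 n j (by omega) (by omega) (by omega) h1]
      have e1 := hSs (j - 1) (by omega)
      have e2 := hSs (n - 1) (by omega)
      have e3 := hxi (n - 1) (by omega) (by omega)
      have e4 := hxi j (by omega) (by omega)
      rw [sub_add_cancel] at e1 e2
      rw [e1, e2]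
      linear_combination (-(x j * i n)) * e3 - x (n - 1) * i (j - 1) * e4
  have hB : ∀ n, 1 ≤ n → n ≤ r →
      γ r n + ν r n * (1 + x (r - 1)) * Ring.inverse (x r) = D n (r + 1) := by
    intro n h1 h2
    have hνe : ν r n = x (n - 1) * i (r - 1) := hν r n hr le_rfl (by omega) h2
    change γ r n + ν r n * (1 + x (r - 1)) * i r = D n (r + 1)
    rw [hνe, hD2 n h1 h2]
    have e1 := hSs (r - 1) (by omega)
    have e3 := hxi (r - 1) (by omega) (by omega)
    rw [sub_add_cancel] at e1
    rcases eq_or_lt_of_le h2 with h | h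
    · subst h
      rw [hγtop n hr le_rfl, e1]
      linear_combination x (n - 1) * i n * e3
    · rw [hγ' r n hr le_rfl (by omega) (by omega), e1]
      have e2 := hSs (n - 1) (by omega)
      have e4 := hxi (n - 1) (by omega) (by omega)
      rw [sub_add_cancel] at e2
      rw [e2]
      linear_combination x (n - 1) * i r * e3 - i n * e4
  intro a u h0 h1 hodd
  obtain ⟨k, rfl⟩ : ∃ k, u = a - 1 + 2 * k := by
    obtain ⟨m, hm⟩ := hodd
    exact ⟨m + 1 - a, by omega⟩
  rw [hTD k a h0 h1]
  clear hodd
  revert k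
  refine per_ind (r + 3) (by omega)
    (fun k => D k (a + k) = τ a (a - 1 + 2 * k)) ?_ 0 ?_
  rotate_left
  · intro k k0 k1
    beta_reduce
    rcases lt_trichotomy k (r - a + 1) with h | h | h
    · rw [hτ1 a k h0 h1 k0 (by omega), hA _ _ (by omega) k0 (by omega)]
    · rw [h, hτ2 a h0 h1, hB _ (by omega) (by omega)]; ring_nf
    · rcases eq_or_lt_of_le (show k ≤ r + 2 by omega) with h' | h'
      · rw [h', hτ4 a h0 h1, hB a h0 h1, hDglide]; ring_nf
      · rw [hτ3 a k h0 h1 (by omega) (by omega), hA _ _ (by omega) (by omega) (by omega),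
          ← hDglide]; ring_nf
  · intro k
    beta_reduce
    rw [show a - 1 + 2 * (k + (r + 3)) = a - 1 + 2 * k + 2 * (r + 3) by ring, hτper a _ h0 h1,
      show a + (k + (r + 3)) = (a + k + 1) + (r + 2) by ring, hDglide,
      show k + (r + 3) - 1 = k + (r + 2) by ring, hDglide, add_sub_cancel_right]
end

section
/- Let R be a commutative ring, r ≥ 4, and let T = {T^{(a)}_1(u)} be a regular solution in R of the level 2 restricted T-system 𝕋_2(D_r): invertible elements T^{(a)}_1(u) ∈ R^× for 1 ≤ a ≤ r and u ∈ ℤ, with a + u odd for a ≤ r−1 and a + u even for a = r, satisfying (whenever the parities allow): T^{(a)}_1(u−1)·T^{(a)}_1(u+1) = 1 + T^{(a−1)}_1(u)·T^{(a+1)}_1(u) for 1 ≤ a ≤ r−3 (with T^{(0)}_1(u) = 1); T^{(r−2)}_1(u−1)·T^{(r−2)}_1(u+1) = 1 + T^{(r−3)}_1(u)·T^{(r−1)}_1(u)·T^{(r)}_1(u); T^{(r−1)}_1(u−1)·T^{(r−1)}_1(u+1) = 1 + T^{(r−2)}_1(u); and T^{(r)}_1(u−1)·T^{(r)}_1(u+1)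 = 1 + T^{(r−2)}_1(u). Then: (1) half-periodicity: T^{(a)}_1(u + 2r) = T^{(ω(a))}_1(u), where ω is the identity on {1,…,r} if r is even, and ω exchanges r−1 and r and fixes all other indices if r is odd; (2) periodicity: T^{(a)}_1(u + 4r) = T^{(a)}_1(u). -/
/-- continuants attached to a sequence `c`. -/
def contK {R : Type*} [CommRing R] (c : ℤ → R) (i : ℤ) : ℕ → R
  | 0 => 0
  | 1 => 1
  | (n + 2) => c (i + n + 1) * contK c i (n + 1) - contK c i n

theorem contK_right {R : Type*} [CommRing R] (c : ℤ → R) (i : ℤ) (n : ℕ) :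
    contK c i (n + 2) = c (i + n + 1) * contK c i (n + 1) - contK c i n := by
  rw [contK]

theorem contK_left {R : Type*} [CommRing R] (c : ℤ → R) (i : ℤ) (n : ℕ) :
    contK c i (n + 2) = c (i + 1) * contK c (i + 1) (n + 1) - contK c (i + 2) n := by
  induction n using Nat.twoStepInduction with
  | zero => simp [contK]
  | one =>
    simp [contK]
    rw [show i + 1 + 1 = i + 2 by ring]
    ring
  | more n h1 h2 =>
    rw [contK_right c i (n + 2), h2, h1, contK_right c (i + 1) (n + 1), contK_right c (i + 2) n]
    have e1 : i + 1 + ((n + 1 : ℕ) : ℤ) + 1 = i + ((n + 2 : ℕ) : ℤ) + 1 := by push_cast; ring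
    have e2 : i + 2 + (n : ℤ) + 1 = i + ((n + 2 : ℕ) : ℤ) + 1 := by push_cast; ring
    rw [e1, e2]
    ring

theorem contK_plucker {R : Type*} [CommRing R] (c : ℤ → R) (i : ℤ) (n : ℕ) :
    contK c i (n + 1) * contK c (i + 1) (n + 1)
      = 1 + contK c i (n + 2) * contK c (i + 1) n := by
  induction n with
  | zero => simp [contK]
  | succ n ih =>
    rw [contK_right c i (n + 1), contK_right c (i + 1) n]
    have e1 : i + 1 + (n : ℤ) + 1 = i + ((n + 1 : ℕ) : ℤ) + 1 := by push_cast; ring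
    rw [e1]
    linear_combination ih

theorem contK_periodic {R : Type*} [CommRing R] (c : ℤ → R) (p : ℤ)
    (hc : ∀ i, c (i + p) = c i) (i : ℤ) (n : ℕ) :
    contK c (i + p) n = contK c i n := by
  induction n using Nat.twoStepInduction with
  | zero => simp [contK]
  | one => simp [contK]
  | more n h1 h2 =>
    rw [contK_right, contK_right, h1, h2, ← hc (i + n + 1)]
    rw [show i + p + (n : ℤ) + 1 = i + n + 1 + p by ring]

theorem core_rec {R : Type*} [CommRing R] (c s t : ℤ → R) (k : ℕ)
    (hs : ∀ i, IsUnit (s i))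
    (hk : ∀ i, IsUnit (contK c i k))
    (h0 : ∀ i, s i * t i = contK c i (k + 1))
    (h1 : ∀ i, s i * t (i + 1) = 1 + contK c (i + 1) k)
    (h2 : ∀ i, t i * s (i + 1) = 1 + contK c (i + 1) k) (i : ℤ) :
    t (i + 2) = c (i + 1) * t (i + 1) - t i := by
  have hp := contK_plucker c i k
  have hX : contK c i (k + 2) = 2 + contK c (i + 1) k := by
    apply (hk (i + 1)).mul_left_cancel
    rw [← h0, ← h0] at hp
    linear_combination s i * t (i + 1) * h2 i + (1 + contK c (i + 1) k) * h1 i - hp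
  have hl := contK_left c i k
  apply (hs (i + 1)).mul_left_cancel
  have a1 := h1 (i + 1)
  rw [show i + 1 + 1 = i + 2 by ring] at a1
  have a2 := h2 i
  have a0 := h0 (i + 1)
  linear_combination a1 + a2 - c (i + 1) * a0 - hX + hl

theorem core_per {R : Type*} [CommRing R] (c s t : ℤ → R) (k : ℕ)
    (hs : ∀ i, IsUnit (s i))
    (hk : ∀ i, IsUnit (contK c i k))
    (h0 : ∀ i, s i * t i = contK c i (k + 1))
    (h1 : ∀ i, s i * t (i + 1) = 1 + contK c (i + 1) k)
    (h2 : ∀ i, t i * s (i + 1) = 1 + contK c (i + 1) k) (i : ℤ) :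
    t (i + (k + 1 : ℕ)) = t i := by
  have key : ∀ n p : ℕ, n + p = k + 1 →
      s i * t (i + n) = contK c i n + contK c (i + n) p := by
    intro n
    induction n using Nat.twoStepInduction with
    | zero =>
      intro p hp
      obtain rfl : p = k + 1 := by omega
      simp [contK, h0]
    | one =>
      intro p hp
      obtain rfl : p = k := by omega
      simp [contK, h1]
    | more n ih1 ih2 =>
      intro p hp
      have b1 := ih1 (p + 2) (by omega)
      have b2 := ih2 (p + 1) (by omega)
      have hr := core_rec c s t k hs hk h0 h1 h2 (i + n)
      have hl := contK_left c (i + n) p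
      have hrr := contK_right c i n
      have e1 : i + ((n + 1 : ℕ) : ℤ) = i + n + 1 := by push_cast; ring
      have e2 : i + ((n + 2 : ℕ) : ℤ) = i + n + 2 := by push_cast; ring
      rw [e1] at b2
      rw [e2, hr, hrr]
      linear_combination c (i + n + 1) * b2 - b1 - hl
  have := key (k + 1) 0 (by omega)
  apply (hs i).mul_left_cancel
  rw [this, h0]
  simp [contK]

theorem core_c {R : Type*} [CommRing R] (c s t : ℤ → R) (k : ℕ)
    (hs : ∀ i, IsUnit (s i)) (ht : ∀ i, IsUnit (t i))
    (hk : ∀ i, IsUnit (contK c i k))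
    (h0 : ∀ i, s i * t i = contK c i (k + 1))
    (h1 : ∀ i, s i * t (i + 1) = 1 + contK c (i + 1) k)
    (h2 : ∀ i, t i * s (i + 1) = 1 + contK c (i + 1) k) (i : ℤ) :
    c (i + (k + 1 : ℕ)) = c i := by
  have hp := core_per c s t k hs hk h0 h1 h2
  have r1 := core_rec c s t k hs hk h0 h1 h2 (i - 1)
  have r2 := core_rec c s t k hs hk h0 h1 h2 (i - 1 + (k + 1 : ℕ))
  rw [show i - 1 + ((k + 1 : ℕ) : ℤ) + 2 = (i - 1 + 2) + (k + 1 : ℕ) by ring,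
    show i - 1 + ((k + 1 : ℕ) : ℤ) + 1 = i + (k + 1 : ℕ) by ring, hp, hp, hp] at r2
  rw [show i - 1 + 1 = i by ring] at r1
  apply (ht i).mul_right_cancel
  linear_combination r1 - r2

/-- Periodicity of the level 2 restricted T-system `𝕋_2(D_r)`: half-period `2r`
with the involution `ω` (identity for even `r`, exchanging `r−1` and `r` for odd
`r`), and full period `4r`. -/
theorem restricted_T2_Dr_periodicity {R : Type*} [CommRing R] (r : ℕ) (hr : 4 ≤ r)
    (T : ℕ → ℤ → R)
    (hunit1 : ∀ a u, 1 ≤ a → a ≤ r - 1 → Odd ((a : ℤ) + u) → IsUnit (T a u))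
    (hunit2 : ∀ u : ℤ, Even ((r : ℤ) + u) → IsUnit (T r u))
    (hsysA : ∀ a u, 1 ≤ a → a ≤ r - 3 → Even ((a : ℤ) + u) →
      T a (u - 1) * T a (u + 1) = 1 + (if a = 1 then 1 else T (a - 1) u) * T (a + 1) u)
    (hsysB : ∀ u : ℤ, Even ((r : ℤ) + u) →
      T (r - 2) (u - 1) * T (r - 2) (u + 1) = 1 + T (r - 3) u * (T (r - 1) u * T r u))
    (hsysC : ∀ u : ℤ, Odd ((r : ℤ) + u) →
      T (r - 1) (u - 1) * T (r - 1) (u + 1) = 1 + T (r - 2) u)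
    (hsysD : ∀ u : ℤ, Odd ((r : ℤ) + u) →
      T r (u - 1) * T r (u + 1) = 1 + T (r - 2) u) :
    (∀ a u, 1 ≤ a → a ≤ r - 2 → Odd ((a : ℤ) + u) →
      T a (u + 2 * (r : ℤ)) = T a u) ∧
    (∀ u : ℤ, Even ((r : ℤ) + u) →
      T (r - 1) (u + 2 * (r : ℤ)) = T (if r % 2 = 1 then r else r - 1) u ∧
      T r (u + 2 * (r : ℤ)) = T (if r % 2 = 1 then r - 1 else r) u) ∧
    (∀ a u, 1 ≤ a → a ≤ r - 2 → Odd ((a : ℤ) + u) →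
      T a (u + 4 * (r : ℤ)) = T a u) ∧
    (∀ u : ℤ, Even ((r : ℤ) + u) →
      T (r - 1) (u + 4 * (r : ℤ)) = T (r - 1) u ∧ T r (u + 4 * (r : ℤ)) = T r u) := by

  classical
  set c : ℤ → R := fun i => T 1 (2 * i) with hc
  set X : ℕ → ℤ → R := fun a u =>
    if a = 0 then 1 else if a ≤ r - 2 then T a u else T (r - 1) u * T r u with hX
  have X0 : ∀ u, X 0 u = 1 := fun u => by simp [hX]
  have Xm : ∀ a u, 1 ≤ a → a ≤ r - 2 → X a u = T a u := fun a u h1 h2 => by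
    simp only [hX]
    rw [if_neg (by omega), if_pos h2]
  have Xt : ∀ u, X (r - 1) u = T (r - 1) u * T r u := fun u => by
    simp only [hX]
    rw [if_neg (by omega), if_neg (by omega)]
  have Xunit : ∀ a u, a ≤ r - 2 → Odd ((a : ℤ) + u) → IsUnit (X a u) := by
    intro a u h ho
    rcases Nat.eq_zero_or_pos a with rfl | h1
    · rw [X0]; exact isUnit_one
    · rw [Xm a u h1 h]; exact hunit1 a u h1 (by omega) ho
  have Xsys : ∀ a u, a + 1 ≤ r - 2 → Even (((a + 1 : ℕ) : ℤ) + u) →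
      X (a + 1) (u - 1) * X (a + 1) (u + 1) = 1 + X a u * X (a + 2) u := by
    intro a u h he
    rw [Xm _ _ (by omega) h, Xm _ _ (by omega) h]
    rcases Nat.lt_or_ge (a + 1) (r - 2) with h3 | h3
    · rw [hsysA (a + 1) u (by omega) (by omega) he, Xm (a + 2) u (by omega) (by omega)]
      rcases Nat.eq_zero_or_pos a with rfl | h1
      · simp [X0]
      · rw [if_neg (by omega), Xm a u h1 (by omega)]
        rfl
    · have ea : a = r - 3 := by omega
      have e1 : a + 1 = r - 2 := by omega
      have e2 : a + 2 = r - 1 := by omega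
      rw [e2, Xt, e1, hsysB u (by
        rw [e1] at he
        rcases he with ⟨y, hy⟩
        exact ⟨y + 1, by omega⟩), Xm a u (by omega) (by omega), ea]
  have hK : ∀ a : ℕ, a ≤ r - 1 → ∀ i : ℤ, contK c i (a + 1) = X a (2 * i + a + 1) := by
    intro a
    induction a using Nat.twoStepInduction with
    | zero => intro _ i; simp [contK, X0]
    | one =>
      intro _ i
      rw [Xm 1 _ le_rfl (by omega)]
      simp only [contK, hc]
      push_cast
      rw [show 2 * (i + 0 + 1) = 2 * i + 1 + 1 by ring]
      ring
    | more a ih1 ih2 =>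
      intro h i
      have hp := contK_plucker c i (a + 1)
      rw [ih2 (by omega), ih2 (by omega), ih1 (by omega)] at hp
      have hx := Xsys a (2 * i + a + 3) (by omega) ⟨i + a + 2, by push_cast; ring⟩
      have e1 : 2 * i + ((a + 1 : ℕ) : ℤ) + 1 = 2 * i + a + 3 - 1 := by push_cast; ring
      have e2 : 2 * (i + 1) + ((a + 1 : ℕ) : ℤ) + 1 = 2 * i + a + 3 + 1 := by push_cast; ring
      have e3 : 2 * (i + 1) + (a : ℤ) + 1 = 2 * i + a + 3 := by ring
      have e4 : 2 * i + ((a + 2 : ℕ) : ℤ) + 1 = 2 * i + a + 3 := by push_cast; ring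
      rw [e1, e2, e3, hx] at hp
      rw [e4]
      apply (Xunit a (2 * i + a + 3) (by omega) ⟨i + a + 1, by ring⟩).mul_left_cancel
      linear_combination -hp
  set s : ℤ → R := fun i => if Even i then T (r - 1) (2 * i + r) else T r (2 * i + r) with hs
  set t : ℤ → R := fun i => if Even i then T r (2 * i + r) else T (r - 1) (2 * i + r) with ht
  have u1 : ∀ i : ℤ, IsUnit (T (r - 1) (2 * i + r)) := fun i =>
    hunit1 _ _ (by omega) le_rfl ⟨i + r - 1, by push_cast [show 1 ≤ r by omega]; ring⟩
  have u2 : ∀ i : ℤ, IsUnit (T r (2 * i + r)) := fun i => hunit2 _ ⟨i + r, by ring⟩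
  have us : ∀ i, IsUnit (s i) := fun i => by
    simp only [hs]; split_ifs
    exacts [u1 i, u2 i]
  have ut : ∀ i, IsUnit (t i) := fun i => by
    simp only [ht]; split_ifs
    exacts [u2 i, u1 i]
  have cr : ((r - 1 : ℕ) : ℤ) = r - 1 := by omega
  have cr2 : ((r - 2 : ℕ) : ℤ) = r - 2 := by omega
  have h0 : ∀ i, s i * t i = contK c i (r - 1 + 1) := by
    intro i
    rw [hK (r - 1) le_rfl, Xt, cr, show 2 * i + ((r : ℤ) - 1) + 1 = 2 * i + r by ring]
    simp only [hs, ht]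
    split_ifs
    · rfl
    · ring
  have hk2 : ∀ i, contK c i (r - 1) = T (r - 2) (2 * i + r - 1) := by
    intro i
    have := hK (r - 2) (by omega) i
    rw [show r - 2 + 1 = r - 1 by omega, Xm _ _ (by omega) le_rfl, cr2] at this
    rw [this]
    congr 1; ring
  have hku : ∀ i, IsUnit (contK c i (r - 1)) := fun i => by
    rw [hk2]
    exact hunit1 _ _ (by omega) (by omega) ⟨i + r - 2, by rw [cr2]; ring⟩
  have hC : ∀ i : ℤ, T (r - 1) (2 * i + r) * T (r - 1) (2 * (i + 1) + r)
      = 1 + contK c (i + 1) (r - 1) := fun i => by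
    have := hsysC (2 * i + r + 1) ⟨i + r, by ring⟩
    rw [hk2]
    convert this using 3 <;> ring_nf
  have hD : ∀ i : ℤ, T r (2 * i + r) * T r (2 * (i + 1) + r)
      = 1 + contK c (i + 1) (r - 1) := fun i => by
    have := hsysD (2 * i + r + 1) ⟨i + r, by ring⟩
    rw [hk2]
    convert this using 3 <;> ring_nf
  have h1 : ∀ i, s i * t (i + 1) = 1 + contK c (i + 1) (r - 1) := by
    intro i
    simp only [hs, ht, Int.even_add_one]
    by_cases h : Even i
    · simp only [h, if_true, not_true, if_false]; exact hC i
    · simp only [h, if_true, not_false_iff, if_false]; exact hD i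
  have h2 : ∀ i, t i * s (i + 1) = 1 + contK c (i + 1) (r - 1) := by
    intro i
    simp only [hs, ht, Int.even_add_one]
    by_cases h : Even i
    · simp only [h, if_true, not_true, if_false]; exact hD i
    · simp only [h, if_true, not_false_iff, if_false]; exact hC i
  have pt := core_per c s t (r - 1) us hku h0 h1 h2
  have ps := core_per c t s (r - 1) ut hku (fun i => by rw [mul_comm, h0]) h2 h1
  have pc := core_c c s t (r - 1) us ut hku h0 h1 h2
  rw [show r - 1 + 1 = r by omega] at pt ps pc
  have A : ∀ a u, 1 ≤ a → a ≤ r - 2 → Odd ((a : ℤ) + u) →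
      T a (u + 2 * (r : ℤ)) = T a u := by
    intro a u ha1 ha2 ⟨y, hy⟩
    have := contK_periodic c r pc (y - a) (a + 1)
    rw [hK a (by omega), hK a (by omega), Xm _ _ ha1 ha2, Xm _ _ ha1 ha2] at this
    convert this using 2 <;> linarith
  have B : ∀ u : ℤ, Even ((r : ℤ) + u) →
      T (r - 1) (u + 2 * (r : ℤ)) = T (if r % 2 = 1 then r else r - 1) u ∧
      T r (u + 2 * (r : ℤ)) = T (if r % 2 = 1 then r - 1 else r) u := by
    intro u ⟨y, hy⟩
    obtain ⟨i, rfl⟩ : ∃ i : ℤ, u = 2 * i + r := ⟨y - r, by linarith⟩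
    have q1 := pt i
    have q2 := ps i
    simp only [hs, ht, Int.even_add, Int.even_coe_nat] at q1 q2
    rw [show 2 * (i + (r : ℤ)) + r = 2 * i + r + 2 * r by ring] at q1 q2
    by_cases hp : Even r
    · have : ¬ (r % 2 = 1) := by rw [Nat.even_iff] at hp; omega
      simp only [this, if_false]
      by_cases h : Even i <;> simp [h, hp] at q1 q2 <;> simp [q1, q2]
    · have : r % 2 = 1 := by rw [Nat.even_iff] at hp; omega
      simp only [this, if_true]
      by_cases h : Even i <;> simp [h, hp] at q1 q2 <;> simp [q1, q2]
  refine ⟨A, B, ?_, ?_⟩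
  · intro a u ha1 ha2 ho
    rw [show u + 4 * (r : ℤ) = u + 2 * r + 2 * r by ring, A a _ ha1 ha2, A a u ha1 ha2 ho]
    rw [← add_assoc]
    exact ho.add_even ⟨r, by ring⟩
  · intro u he
    have he2 : Even ((r : ℤ) + (u + 2 * r)) := by
      rw [← add_assoc]
      exact he.add ⟨r, by ring⟩
    obtain ⟨b1, b2⟩ := B u he
    obtain ⟨b3, b4⟩ := B _ he2
    rw [show u + 4 * (r : ℤ) = u + 2 * r + 2 * r by ring, b3, b4]
    by_cases hp : r % 2 = 1
    · simp only [hp, if_true] at b1 b2 ⊢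
      exact ⟨b2, b1⟩
    · simp only [hp, if_false] at b1 b2 ⊢
      exact ⟨b1, b2⟩
end

section
/- Let R be a commutative ring, r ≥ 2, and let T be a regular solution in R of the level 2 restricted T-system 𝕋_2(B_r): invertible elements T^{(a)}_1(u) ∈ R^× for 1 ≤ a ≤ r−1 and u ∈ ℤ, T^{(r)}_2(u) ∈ R^× for u ∈ ℤ, and T^{(r)}_1(u), T^{(r)}_3(u) ∈ R^× for u ∈ ℤ + 1/2, satisfying: (i) for 1 ≤ a ≤ r−2, u ∈ ℤ: T^{(a)}_1(u−1)·T^{(a)}_1(u+1) = 1 + T^{(a−1)}_1(u)·T^{(a+1)}_1(u) (with T^{(0)}_1(u) = 1); (ii) for u ∈ ℤ: T^{(r−1)}_1(u−1)·T^{(r−1)}_1(u+1) = 1 + T^{(r−2)}_1(u)·T^{(r)}_2(u); (iii) for u ∈ ℤ: T^{(r)}_1(u−1/2)·T^{(r)}_1(u+1/2) = T^{(r)}_2(u) + T^{(r−1)}_1(u); (iv) for u ∈ ℤ + 1/2: T^{(r)}_2(u−1/2)·T^{(r)}_2(u+1/2) = T^{(r)}_1(u)·T^{(r)}_3(u) +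 T^{(r−1)}_1(u−1/2)·T^{(r−1)}_1(u+1/2); (v) for u ∈ ℤ: T^{(r)}_3(u−1/2)·T^{(r)}_3(u+1/2) = T^{(r)}_2(u) + T^{(r−1)}_1(u). Then: (1) half-periodicity: T^{(a)}_1(u + 2r + 1) = T^{(a)}_1(u) for 1 ≤ a ≤ r−1; T^{(r)}_1(u + 2r + 1) = T^{(r)}_3(u); T^{(r)}_2(u + 2r + 1) = T^{(r)}_2(u); T^{(r)}_3(u + 2r + 1) = T^{(r)}_1(u); (2) periodicity: each generator is invariant under the shift u ↦ u + 2(2r + 1). -/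
theorem aux_core1 {R : Type*} [CommRing R] (p q p' q' z z' qm qn pm pn c c' F : R)
    (h1 : qm * q' = 1 + z * p) (h2 : q * qn = 1 + z' * p')
    (h3 : pm + z' = c * q) (h4 : pn + z = c' * q')
    (h5 : (pm * p - qm * q) * F = (p + q) ^ 2)
    (h6 : (p' * pn - q' * qn) * F = (p' + q') ^ 2)
    (hF : F = p * p' - q * q')
    (uF : IsUnit F) (up : IsUnit p) (up' : IsUnit p') (uq : IsUnit q) (uq' : IsUnit q') :
    c = c' ∧ c * F = (qm - z') * (p' + q') + (qn - z) * (p + q) := by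
  have E1 : F * p * q * q' * c
      = q' * (p + q) ^ 2 + F * q * (1 + z * p) + F * p * z' * q' := by
    linear_combination (-F * p * q') * h3 + q' * h5 + F * q * h1
  have E2 : F * p' * q * q' * c'
      = q * (p' + q') ^ 2 + F * q' * (1 + z' * p') + F * p' * z * q := by
    linear_combination (-F * p' * q) * h4 + q * h6 + F * q' * h2
  constructor
  · apply ((((uF.mul up).mul up').mul uq).mul uq').mul_left_cancel
    subst hF
    linear_combination p' * E1 - p * E2
  · apply ((up.mul uq).mul uq').mul_left_cancel
    have e1 : p * q * q' * ((qm - z') * (p' + q') + (qn - z) * (p + q))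
      = p * q * ((1 + z * p) - q' * z') * (p' + q') + p * q' * ((1 + z' * p') - q * z) * (p + q) := by
      linear_combination p * q * (p' + q') * h1 + p * q' * (p + q) * h2
    rw [e1]
    subst hF
    linear_combination E1

theorem aux_LR {R : Type*} [CommRing R] (r : ℕ) (s : ℕ → ℤ → R)
    (h0 : ∀ u, s 0 u = 0) (h1 : ∀ u, s 1 u = 1)
    (hu : ∀ k u, 1 ≤ k → k ≤ r + 1 → IsUnit (s k u))
    (hs : ∀ k u, k + 1 ≤ r → s (k + 1) (u - 1) * s (k + 1) (u + 1) = 1 + s k u * s (k + 2) u)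
    (k : ℕ) (hk : k + 1 ≤ r) : ∀ u,
    s (k + 2) u + s k (u - 2) = s 2 (u + k) * s (k + 1) (u - 1) := by
  induction k with
  | zero => intro u; simp [h0, h1]
  | succ k ih =>
    intro u
    apply (hu (k + 1) u (by omega) (by omega)).mul_left_cancel
    have a1 := hs (k + 1) u (by omega)
    have a2 := hs k (u - 1) (by omega)
    have a3 := ih (by omega) (u + 1)
    rw [show u - 1 - 1 = u - 2 by ring, show u - 1 + 1 = u by ring] at a2
    rw [show u + 1 - 2 = u - 1 by ring, show u + 1 + (k : ℤ) = u + k + 1 by ring,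
      show u + 1 - 1 = u by ring] at a3
    rw [show u + ((k + 1 : ℕ) : ℤ) = u + k + 1 by push_cast; ring]
    simp only [Nat.add_assoc, Nat.reduceAdd] at a1 a2 a3 ⊢
    linear_combination s (k + 2) (u - 1) * a3 - a1 + a2

theorem aux_LL {R : Type*} [CommRing R] (r : ℕ) (s : ℕ → ℤ → R)
    (h0 : ∀ u, s 0 u = 0) (h1 : ∀ u, s 1 u = 1)
    (hu : ∀ k u, 1 ≤ k → k ≤ r + 1 → IsUnit (s k u))
    (hs : ∀ k u, k + 1 ≤ r → s (k + 1) (u - 1) * s (k + 1) (u + 1) = 1 + s k u * s (k + 2) u)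
    (k : ℕ) (hk : k + 1 ≤ r) (u : ℤ) :
    s (k + 2) u + s k (u + 2) = s 2 (u - k) * s (k + 1) (u + 1) := by
  have := aux_LR r (fun k u => s k (-u)) (fun u => h0 _) (fun u => h1 _)
    (fun k u => hu k _) (fun k u hk => by
      have := hs k (-u) hk
      rw [show -(u - 1) = -u + 1 by ring, show -(u + 1) = -u - 1 by ring, mul_comm]
      exact this) k hk (-u)
  rw [show - -u = u by ring, show -(-u - 2) = u + 2 by ring, show -(-u + (k : ℤ)) = u - k by ring,
    show -(-u - 1) = u + 1 by ring] at this
  exact this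

theorem aux_main {R : Type*} [CommRing R] (m : ℕ) (s : ℕ → ℤ → R) (x y : ℤ → R)
    (h0 : ∀ u, s 0 u = 0) (h1 : ∀ u, s 1 u = 1)
    (hu : ∀ k u, 1 ≤ k → k ≤ m + 2 → IsUnit (s k u))
    (hs : ∀ k u, k ≤ m → s (k + 1) (u - 1) * s (k + 1) (u + 1) = 1 + s k u * s (k + 2) u)
    (hx : ∀ u, IsUnit (x u)) (hy : ∀ u, IsUnit (y u))
    (hC : ∀ u, x (u - 1) * x u = s (m + 2) u + s (m + 1) u)
    (hE : ∀ u, y (u - 1) * y u = s (m + 2) u + s (m + 1) u)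
    (hD : ∀ u, s (m + 2) u * s (m + 2) (u + 1)
      = x u * y u + s (m + 1) u * s (m + 1) (u + 1)) :
    (∀ k u, k ≤ m + 2 → s k (u + (2 * m + 3)) = s k u) ∧
    (∀ u, x (u + (2 * m + 3)) = y u) := by
  have LR := aux_LR (m + 1) s h0 h1 (fun k u a b => hu k u a (by omega))
    (fun k u a => hs k u (by omega))
  have LL := aux_LL (m + 1) s h0 h1 (fun k u a b => hu k u a (by omega))
    (fun k u a => hs k u (by omega))
  have core : ∀ n : ℤ, s 2 (n - (m + 1)) = s 2 (n + (m + 2)) ∧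
      s 2 (n - (m + 1)) * x n = x (n - 2) + x (n + 2) := by
    intro n
    have b1 := hs m n le_rfl
    have b2 := hs m (n + 1) le_rfl
    have b3 := LL m le_rfl (n - 1)
    have b4 := LR m le_rfl (n + 2)
    have d0 := hD (n - 1)
    have d1 := hD n
    have d2 := hD (n + 1)
    have c0 := hC (n - 1)
    have c1 := hC n
    have c2 := hC (n + 1)
    have c3 := hC (n + 2)
    have e1 := hE n
    have e2 := hE (n + 1)
    rw [show n + 1 - 1 = n by ring] at b2 c2 e2
    rw [show n + 1 + 1 = n + 2 by ring] at b2 d2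
    rw [show n - 1 + 1 = n by ring] at b3 d0
    rw [show n - 1 + 2 = n + 1 by ring, show n - 1 - (m : ℤ) = n - (m + 1) by ring] at b3
    rw [show n + 2 - 2 = n by ring, show n + 2 + (m : ℤ) = n + (m + 2) by ring] at b4
    rw [show n + 2 - 1 = n + 1 by ring] at b4 c3
    rw [show n - 1 - 1 = n - 2 by ring] at c0
    have key := aux_core1 (s (m + 2) n) (s (m + 1) n) (s (m + 2) (n + 1)) (s (m + 1) (n + 1))
      (s m n) (s m (n + 1)) (s (m + 1) (n - 1)) (s (m + 1) (n + 2))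
      (s (m + 2) (n - 1)) (s (m + 2) (n + 2)) (s 2 (n - (m + 1))) (s 2 (n + (m + 2)))
      (x n * y n) b1 b2 b3 b4
      (by
        have : s (m + 2) (n - 1) * s (m + 2) n - s (m + 1) (n - 1) * s (m + 1) n
          = x (n - 1) * y (n - 1) := by linear_combination d0
        rw [this, sq]; nth_rewrite 1 [← c1]; rw [← e1]; ring)
      (by
        have : s (m + 2) (n + 1) * s (m + 2) (n + 2) - s (m + 1) (n + 1) * s (m + 1) (n + 2)
          = x (n + 1) * y (n + 1) := by linear_combination d2
        rw [this, sq]; nth_rewrite 1 [← c2]; rw [← e2]; ring)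
      (by linear_combination -d1) ((hx n).mul (hy n))
      (hu _ _ (by omega) (by omega)) (hu _ _ (by omega) (by omega))
      (hu _ _ (by omega) (by omega)) (hu _ _ (by omega) (by omega))
    obtain ⟨k1, k2⟩ := key
    refine ⟨k1, ?_⟩
    rw [← k1] at b4
    generalize s 2 (n - (m + 1)) = c at *
    have key2 : c * (s (m + 2) n + s (m + 1) n) * (s (m + 2) (n + 1) + s (m + 1) (n + 1))
       = (s (m + 2) (n - 1) + s (m + 1) (n - 1)) * (s (m + 2) (n + 1) + s (m + 1) (n + 1))
        + (s (m + 2) (n + 2) + s (m + 1) (n + 2)) * (s (m + 2) n + s (m + 1) n) := by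
      linear_combination k2 + c * d1 - (s (m + 2) (n + 1) + s (m + 1) (n + 1)) * b3
        - (s (m + 2) n + s (m + 1) n) * b4
    apply (((hx (n - 1)).mul (hx n)).mul (hx (n + 1))).mul_left_cancel
    rw [← c0, ← c1, ← c2, ← c3] at key2
    linear_combination key2
  have per2 : ∀ u, s 2 (u + (2 * m + 3)) = s 2 u := by
    intro u
    have := (core (u + (m + 1))).1
    rw [show u + ((m : ℤ) + 1) - (m + 1) = u by ring,
      show u + ((m : ℤ) + 1) + (m + 2) = u + (2 * m + 3) by ring] at this
    exact this.symm
  have per : ∀ k, (k + 1 ≤ m + 2 → (∀ u, s k (u + (2 * m + 3)) = s k u) ∧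
      (∀ u, s (k + 1) (u + (2 * m + 3)) = s (k + 1) u)) := by
    intro k
    induction k with
    | zero => intro _; simp [h0, h1]
    | succ k ih =>
      intro hk
      obtain ⟨i1, i2⟩ := ih (by omega)
      refine ⟨i2, fun u => ?_⟩
      have a := LR k (by omega) u
      have b := LR k (by omega) (u + (2 * m + 3))
      rw [show u + (2 * (m : ℤ) + 3) - 2 = (u - 2) + (2 * m + 3) by ring,
        show u + (2 * (m : ℤ) + 3) - 1 = (u - 1) + (2 * m + 3) by ring,
        show u + (2 * (m : ℤ) + 3) + k = (u + k) + (2 * m + 3) by ring, i1, i2, per2] at b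
      linear_combination b - a
  refine ⟨fun k u hk => ?_, fun u => ?_⟩
  · rcases Nat.lt_or_ge k (m + 2) with h | h
    · exact (per k (by omega)).1 u
    · obtain rfl : k = m + 2 := by omega
      exact (per (m + 1) (by omega)).2 u
  · have lin : ∀ (n : ℤ) (k : ℕ), k + 1 ≤ m + 1 →
        (x (n + 2 * k + 2) = s (k + 1) (n + k - m) * x (n + 2) - s k (n + k + 1 - m) * x n) ∧
        (x (n + 2 * k + 4) = s (k + 2) (n + k + 1 - m) * x (n + 2)
          - s (k + 1) (n + k + 2 - m) * x n) := by
      intro n k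
      induction k with
      | zero =>
        intro _
        have := (core (n + 2)).2
        rw [show n + 2 - ((m : ℤ) + 1) = n + 1 - m by ring, show n + 2 - 2 = n by ring,
          show n + 2 + 2 = n + 4 by ring] at this
        simp [h0, h1]
        linear_combination -this
      | succ k ih =>
        intro hk
        obtain ⟨i1, i2⟩ := ih (by omega)
        have := (core (n + 2 * k + 4)).2
        have l1 := LR (k + 1) (by omega) (n + k + 2 - m)
        have l2 := LR k (by omega) (n + k + 3 - m)
        push_cast at l1 ⊢
        rw [show n + 2 * (k : ℤ) + 4 - (m + 1) = n + 2 * k + 3 - m by ring,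
          show n + 2 * (k : ℤ) + 4 - 2 = n + 2 * k + 2 by ring,
          show n + 2 * (k : ℤ) + 4 + 2 = n + 2 * k + 6 by ring] at this
        rw [show n + (k : ℤ) + 2 - m - 2 = n + k - m by ring,
          show n + (k : ℤ) + 2 - m + (k + 1) = n + 2 * k + 3 - m by ring,
          show n + (k : ℤ) + 2 - m - 1 = n + k + 1 - m by ring] at l1
        rw [show n + (k : ℤ) + 3 - m - 2 = n + k + 1 - m by ring,
          show n + (k : ℤ) + 3 - m + k = n + 2 * k + 3 - m by ring,
          show n + (k : ℤ) + 3 - m - 1 = n + k + 2 - m by ring] at l2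
        rw [show n + 2 * ((k : ℤ) + 1) + 2 = n + 2 * k + 4 by ring,
          show n + 2 * ((k : ℤ) + 1) + 4 = n + 2 * k + 6 by ring,
          show n + ((k : ℤ) + 1) - m = n + k + 1 - m by ring,
          show n + ((k : ℤ) + 1) + 1 - m = n + k + 2 - m by ring,
          show n + ((k : ℤ) + 1) + 2 - m = n + k + 3 - m by ring]
        simp only [Nat.add_assoc, Nat.reduceAdd] at l1 l2 i1 i2 ⊢
        refine ⟨i2, ?_⟩
        linear_combination s 2 (n + 2 * k + 3 - m) * i2 - i1 - this - x (n + 2) * l1 + x n * l2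
    have a := (lin (u - 1) m le_rfl).2
    rw [show u - 1 + 2 * (m : ℤ) + 4 = u + (2 * m + 3) by ring,
      show u - 1 + (m : ℤ) + 1 - m = u by ring, show u - 1 + (m : ℤ) + 2 - m = u + 1 by ring,
      show u - 1 + 2 = u + 1 by ring] at a
    have c1 := hC u
    have c2 := hC (u + 1)
    rw [show u + 1 - 1 = u by ring] at c2
    apply (hx u).mul_left_cancel
    linear_combination x u * a + hD u + s (m + 2) u * c2 - s (m + 1) (u + 1) * c1



/-- Periodicity of the level 2 restricted T-system `𝕋_2(B_r)`.
Here `T1 a u` denotes `T^{(a)}_1(u)` for `1 ≤ a ≤ r−1`, `u ∈ ℤ`;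
`Tr2 u` denotes `T^{(r)}_2(u)` for `u ∈ ℤ`; and `Tr1 n`, `Tr3 n` denote
`T^{(r)}_1(n + 1/2)`, `T^{(r)}_3(n + 1/2)` for `n ∈ ℤ` (encoding `u ∈ ℤ + 1/2`). -/
theorem restricted_T2_Br_periodicity {R : Type*} [CommRing R] (r : ℕ) (hr : 2 ≤ r)
    (T1 : ℕ → ℤ → R) (Tr1 Tr2 Tr3 : ℤ → R)
    (hu1 : ∀ a u, 1 ≤ a → a ≤ r - 1 → IsUnit (T1 a u))
    (hu2 : ∀ u : ℤ, IsUnit (Tr2 u))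
    (hu13 : ∀ n : ℤ, IsUnit (Tr1 n) ∧ IsUnit (Tr3 n))
    (hsysA : ∀ a u, 1 ≤ a → a ≤ r - 2 →
      T1 a (u - 1) * T1 a (u + 1)
        = 1 + (if a = 1 then 1 else T1 (a - 1) u) * T1 (a + 1) u)
    (hsysB : ∀ u : ℤ,
      T1 (r - 1) (u - 1) * T1 (r - 1) (u + 1)
        = 1 + (if r = 2 then 1 else T1 (r - 2) u) * Tr2 u)
    (hsysC : ∀ u : ℤ, Tr1 (u - 1) * Tr1 u = Tr2 u + T1 (r - 1) u)
    (hsysD : ∀ n : ℤ, Tr2 n * Tr2 (n + 1) = Tr1 n * Tr3 n + T1 (r - 1) n * T1 (r - 1) (n + 1))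
    (hsysE : ∀ u : ℤ, Tr3 (u - 1) * Tr3 u = Tr2 u + T1 (r - 1) u) :
    (∀ a u, 1 ≤ a → a ≤ r - 1 → T1 a (u + (2 * (r : ℤ) + 1)) = T1 a u) ∧
    (∀ n : ℤ, Tr1 (n + (2 * (r : ℤ) + 1)) = Tr3 n) ∧
    (∀ u : ℤ, Tr2 (u + (2 * (r : ℤ) + 1)) = Tr2 u) ∧
    (∀ n : ℤ, Tr3 (n + (2 * (r : ℤ) + 1)) = Tr1 n) ∧
    (∀ a u, 1 ≤ a → a ≤ r - 1 → T1 a (u + 2 * (2 * (r : ℤ) + 1)) = T1 a u) ∧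
    (∀ n : ℤ, Tr1 (n + 2 * (2 * (r : ℤ) + 1)) = Tr1 n) ∧
    (∀ u : ℤ, Tr2 (u + 2 * (2 * (r : ℤ) + 1)) = Tr2 u) ∧
    (∀ n : ℤ, Tr3 (n + 2 * (2 * (r : ℤ) + 1)) = Tr3 n) := by
  obtain ⟨m, rfl⟩ : ∃ m, r = m + 2 := ⟨r - 2, by omega⟩
  obtain ⟨s, hsdef⟩ : ∃ s : ℕ → ℤ → R, s = fun k u =>
    if k = 0 then 0 else if k = 1 then 1 else if k = m + 3 then Tr2 u else T1 (k - 1) u := ⟨_, rfl⟩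
  have s0 : ∀ u, s 0 u = 0 := by intro u; simp [hsdef]
  have s1 : ∀ u, s 1 u = 1 := by intro u; simp [hsdef]
  have sr : ∀ u, s (m + 3) u = Tr2 u := by intro u; simp [hsdef]
  have st : ∀ a u, 1 ≤ a → a ≤ m + 1 → s (a + 1) u = T1 a u := by
    intro a u h1 h2
    simp only [hsdef]
    rw [if_neg (by omega), if_neg (by omega), if_neg (by omega), Nat.add_sub_cancel]
  have hu : ∀ k u, 1 ≤ k → k ≤ (m + 1) + 2 → IsUnit (s k u) := by
    intro k u h1 h2
    rcases Nat.lt_or_ge k (m + 3) with h | h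
    · obtain ⟨a, rfl⟩ : ∃ a, k = a + 1 := ⟨k - 1, by omega⟩
      rcases Nat.eq_zero_or_pos a with rfl | ha
      · rw [s1]; exact isUnit_one
      · rw [st a u ha (by omega)]; exact hu1 a u ha (by omega)
    · obtain rfl : k = m + 3 := by omega
      rw [sr]; exact hu2 u
  have hs : ∀ k u, k ≤ m + 1 →
      s (k + 1) (u - 1) * s (k + 1) (u + 1) = 1 + s k u * s (k + 2) u := by
    intro k u hk
    rcases Nat.eq_zero_or_pos k with rfl | hk0
    · simp [s0, s1]
    rw [st k _ hk0 hk, st k _ hk0 hk]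
    have prev : s k u = if k = 1 then 1 else T1 (k - 1) u := by
      split_ifs with h
      · rw [h, s1]
      · obtain ⟨a, rfl⟩ : ∃ a, k = a + 1 := ⟨k - 1, by omega⟩
        rw [st a u (by omega) (by omega), Nat.add_sub_cancel]
    rw [prev]
    rcases Nat.lt_or_ge k (m + 1) with h | h
    · rw [hsysA k u hk0 (by omega), st (k + 1) u (by omega) (by omega)]
    · obtain rfl : k = m + 1 := by omega
      have := hsysB u
      rw [show m + 2 - 1 = m + 1 by omega, show m + 2 - 2 = m by omega] at this
      rw [this, sr, Nat.add_sub_cancel]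
      simp
  have tq : ∀ u, s (m + 1 + 1) u = T1 (m + 2 - 1) u := fun u => st (m + 1) u (by omega) le_rfl
  have hC : ∀ u, Tr1 (u - 1) * Tr1 u = s (m + 1 + 2) u + s (m + 1 + 1) u := by
    intro u; rw [tq, sr]; exact hsysC u
  have hE : ∀ u, Tr3 (u - 1) * Tr3 u = s (m + 1 + 2) u + s (m + 1 + 1) u := by
    intro u; rw [tq, sr]; exact hsysE u
  have hD : ∀ u, s (m + 1 + 2) u * s (m + 1 + 2) (u + 1)
      = Tr1 u * Tr3 u + s (m + 1 + 1) u * s (m + 1 + 1) (u + 1) := by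
    intro u; rw [tq, tq, sr, sr]; exact hsysD u
  obtain ⟨A, B⟩ := aux_main (m + 1) s Tr1 Tr3 s0 s1 hu hs (fun u => (hu13 u).1)
    (fun u => (hu13 u).2) hC hE hD
  obtain ⟨-, C⟩ := aux_main (m + 1) s Tr3 Tr1 s0 s1 hu hs (fun u => (hu13 u).2)
    (fun u => (hu13 u).1) hE hC (fun u => by rw [hD u, mul_comm (Tr1 u)])
  have e : 2 * ((m + 1 : ℕ) : ℤ) + 3 = 2 * ((m + 2 : ℕ) : ℤ) + 1 := by push_cast; ring
  rw [e] at A B C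
  generalize 2 * ((m + 2 : ℕ) : ℤ) + 1 = N at *
  have P1 : ∀ a u, 1 ≤ a → a ≤ m + 2 - 1 → T1 a (u + N) = T1 a u := by
    intro a u h1 h2
    rw [← st a _ h1 (by omega), ← st a _ h1 (by omega)]
    exact A _ _ (by omega)
  have P2 : ∀ u, Tr2 (u + N) = Tr2 u := by
    intro u; rw [← sr, ← sr]; exact A _ _ le_rfl
  have dbl : ∀ u : ℤ, u + 2 * N = u + N + N := fun u => by ring
  refine ⟨P1, B, P2, C, ?_, ?_, ?_, ?_⟩
  · intro a u h1 h2; rw [dbl, P1 _ _ h1 h2, P1 _ _ h1 h2]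
  · intro u; rw [dbl, B, C]
  · intro u; rw [dbl, P2, P2]
  · intro u; rw [dbl, C, B]
end

section
/- Let G be an abelian group (written multiplicatively), r ≥ 4, and let T^{(a)} : ℤ → G (1 ≤ a ≤ r) be a family satisfying the level 0 restricted T-system 𝕋_0(D_r): for all u ∈ ℤ, T^{(a)}(u−1)·T^{(a)}(u+1) = ∏_{b adjacent to a in D_r} T^{(b)}(u). Then: (1) half-periodicity: T^{(a)}(u + 2r − 2) = T^{(ω(a))}(u)^{−1}, where ω is the identity on {1,…,r} if r is even, and ω exchanges r−1 and r and fixes all other indices if r is odd; (2) periodicity: T^{(a)}(u + 2(2r − 2)) = T^{(a)}(u). -/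
theorem aux_add {G : Type*} [AddCommGroup G] (n : ℕ) (hn : 1 ≤ n)
    (T : ℕ → ℤ → G)
    (h1 : ∀ u : ℤ, T 1 (u - 1) + T 1 (u + 1) = T 2 u)
    (hA : ∀ a u, 1 ≤ a → a + 1 ≤ n →
      T (a + 1) (u - 1) + T (a + 1) (u + 1) = T a u + T (a + 2) u)
    (hB : ∀ u : ℤ, T (n + 1) (u - 1) + T (n + 1) (u + 1)
      = T n u + T (n + 2) u + T (n + 3) u)
    (hC : ∀ u : ℤ, T (n + 2) (u - 1) + T (n + 2) (u + 1) = T (n + 1) u)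
    (hD : ∀ u : ℤ, T (n + 3) (u - 1) + T (n + 3) (u + 1) = T (n + 1) u) :
    (∀ a u, 1 ≤ a → a ≤ n + 1 → T a (u + (2 * (n : ℤ) + 4)) = - T a u) ∧
    (n % 2 = 0 → ∀ u, T (n + 2) (u + (2 * (n : ℤ) + 4)) = - T (n + 3) u ∧
      T (n + 3) (u + (2 * (n : ℤ) + 4)) = - T (n + 2) u) ∧
    (n % 2 = 1 → ∀ u, T (n + 2) (u + (2 * (n : ℤ) + 4)) = - T (n + 2) u ∧
      T (n + 3) (u + (2 * (n : ℤ) + 4)) = - T (n + 3) u) := by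
  obtain ⟨P, hP⟩ : ∃ P : ℕ → ℤ → G, P = fun k u => ∑ i ∈ Finset.range k, T 1 (u + 2 * i) :=
    ⟨_, rfl⟩
  have P0 : ∀ u, P 0 u = 0 := by simp [hP]
  have Ps : ∀ k u, P (k + 1) u = P k u + T 1 (u + 2 * k) := by
    intro k u; simp [hP, Finset.sum_range_succ]
  have Pt : ∀ k u, P (k + 1) u = T 1 u + P k (u + 2) := by
    intro k u
    simp only [hP, Finset.sum_range_succ']
    rw [add_comm]
    congr 1
    · simp
    · apply Finset.sum_congr rfl
      intro i _
      congr 1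
      push_cast; ring
  have P1 : ∀ u, P 1 u = T 1 u := by intro u; simp [hP]
  have key : ∀ k : ℕ, k + 1 ≤ n → (∀ u, T (k + 1) u = P (k + 1) (u - k)) ∧
      (∀ u, T (k + 2) u = P (k + 2) (u - k - 1)) := by
    intro k
    induction k with
    | zero =>
      intro _
      refine ⟨fun u => by simp [P1], fun u => ?_⟩
      rw [Ps 1, P1, ← h1]
      congr 2
      · simp
      · push_cast; ring
    | succ k ih =>
      intro hk
      obtain ⟨i1, i2⟩ := ih (by omega)
      refine ⟨fun u => by rw [i2]; congr 1; push_cast; ring, fun u => ?_⟩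
      have e := hA (k + 1) u (by omega) (by omega)
      rw [i1, i2, i2] at e
      have e1 := Ps (k + 2) (u - k - 2)
      have e2 := Ps (k + 1) (u - k)
      rw [show u - 1 - (k : ℤ) - 1 = u - k - 2 by ring,
        show u + 1 - (k : ℤ) - 1 = u - k by ring] at e
      rw [show u - (k : ℤ) - 2 + 2 * ((k + 2 : ℕ) : ℤ) = u - k + 2 * ((k + 1 : ℕ) : ℤ) by
        push_cast; ring] at e1
      rw [show u - ((k + 1 : ℕ) : ℤ) - 1 = u - k - 2 by push_cast; ring]
      grind
  have hT : ∀ a u, a ≤ n → T (a + 1) u = P (a + 1) (u - a) := by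
    intro a u ha
    rcases Nat.lt_or_ge a n with h | h
    · exact (key a (by omega)).1 u
    · obtain rfl : a = n := by omega
      obtain ⟨b, rfl⟩ : ∃ b, a = b + 1 := ⟨a - 1, by omega⟩
      rw [(key b le_rfl).2]; congr 1; push_cast; ring
  have hTn : ∀ u, T n u = P n (u - n + 1) := by
    intro u
    obtain ⟨b, rfl⟩ : ∃ b, n = b + 1 := ⟨n - 1, by omega⟩
    rw [hT b u (by omega)]; congr 1; push_cast; ring
  have hS : ∀ u, T (n + 2) u + T (n + 3) u = P (n + 2) (u - n - 1) := by
    intro u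
    have e := hB u
    rw [hT n _ le_rfl, hT n _ le_rfl, hTn] at e
    have e1 := Ps (n + 1) (u - n - 1)
    have e2 := Ps n (u - n + 1)
    rw [show u - 1 - (n : ℤ) = u - n - 1 by ring,
        show u + 1 - (n : ℤ) = u - n + 1 by ring] at e
    rw [show u - (n : ℤ) - 1 + 2 * ((n + 1 : ℕ) : ℤ) = u - n + 1 + 2 * (n : ℤ) by
        push_cast; ring] at e1
    grind
  have anti : ∀ u, T 1 (u + (2 * (n : ℤ) + 4)) = - T 1 u := by
    intro u
    have s1 := hS (u + n + 1)
    have s2 := hS (u + n + 3)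
    have c := hC (u + n + 2)
    have d := hD (u + n + 2)
    rw [hT n _ le_rfl] at c d
    have e1 := Pt (n + 1) u
    have e2 := Ps (n + 1) (u + 2)
    rw [show u + n + 2 - 1 = u + n + 1 by ring, show u + n + 2 + 1 = u + n + 3 by ring,
      show u + n + 2 - n = u + 2 by ring] at c d
    rw [show u + n + 1 - n - 1 = u by ring] at s1
    rw [show u + n + 3 - n - 1 = u + 2 by ring] at s2
    rw [show u + 2 + 2 * ((n + 1 : ℕ) : ℤ) = u + (2 * (n : ℤ) + 4) by push_cast; ring] at e2
    grind
  have stepA : ∀ u, T (n + 2) (u + 2) = T (n + 3) u - T 1 (u - n - 1) ∧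
      T (n + 3) (u + 2) = T (n + 2) u - T 1 (u - n - 1) := by
    intro u
    have s := hS u
    have c := hC (u + 1)
    have d := hD (u + 1)
    rw [hT n _ le_rfl] at c d
    have e1 := Pt (n + 1) (u - n - 1)
    rw [show u + 1 - 1 = u by ring, show u + 1 + 1 = u + 2 by ring,
      show u + 1 - (n : ℤ) = u - n - 1 + 2 by ring] at c d
    constructor <;> grind
  have iter : ∀ (k : ℕ) u,
      (k % 2 = 0 → T (n + 2) (u + 2 * k) = T (n + 2) u - P k (u - n - 1) ∧
        T (n + 3) (u + 2 * k) = T (n + 3) u - P k (u - n - 1)) ∧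
      (k % 2 = 1 → T (n + 2) (u + 2 * k) = T (n + 3) u - P k (u - n - 1) ∧
        T (n + 3) (u + 2 * k) = T (n + 2) u - P k (u - n - 1)) := by
    intro k u
    induction k with
    | zero => simp [P0]
    | succ k ih =>
      have st := stepA (u + 2 * k)
      have e := Ps k (u - n - 1)
      rw [show u + 2 * (k : ℤ) - n - 1 = u - n - 1 + 2 * k by ring] at st
      rw [show u + 2 * ((k + 1 : ℕ) : ℤ) = u + 2 * k + 2 by push_cast; ring]
      rcases Nat.mod_two_eq_zero_or_one k with h | h
      · have := ih.1 h
        refine ⟨fun _ => by omega, fun _ => ?_⟩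
        rw [st.1, st.2, this.1, this.2, e]
        constructor <;> abel
      · have := ih.2 h
        refine ⟨fun _ => ?_, fun _ => by omega⟩
        rw [st.1, st.2, this.1, this.2, e]
        constructor <;> abel
  refine ⟨?_, ?_, ?_⟩
  · intro a u h h'
    obtain ⟨b, rfl⟩ : ∃ b, a = b + 1 := ⟨a - 1, by omega⟩
    rw [hT b _ (by omega), hT b _ (by omega)]
    simp only [hP, ← Finset.sum_neg_distrib]
    apply Finset.sum_congr rfl
    intro i _
    rw [← anti]; congr 1; ring
  · intro h u
    have := (iter (n + 2) u).1 (by omega)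
    rw [← hS, show u + 2 * ((n + 2 : ℕ) : ℤ) = u + (2 * (n : ℤ) + 4) by push_cast; ring] at this
    rw [this.1, this.2]
    constructor <;> abel
  · intro h u
    have := (iter (n + 2) u).2 (by omega)
    rw [← hS, show u + 2 * ((n + 2 : ℕ) : ℤ) = u + (2 * (n : ℤ) + 4) by push_cast; ring] at this
    rw [this.1, this.2]
    constructor <;> abel

/-- Periodicity of the level 0 restricted T-system `𝕋_0(D_r)` in an abelian group:
half-period `h^∨ = 2r−2` up to the involution `ω` and inversion, full period
`2(2r−2)`.  Here `ω` is the identity for even `r` and exchanges `r−1`, `r` for odd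
`r` (so `ω(a) = 2r−1−a` for `a ∈ {r−1, r}` when `r` is odd). -/
theorem restricted_T0_Dr_periodicity {G : Type*} [CommGroup G] (r : ℕ) (hr : 4 ≤ r)
    (T : ℕ → ℤ → G)
    (h1 : ∀ u : ℤ, T 1 (u - 1) * T 1 (u + 1) = T 2 u)
    (hA : ∀ a u, 2 ≤ a → a ≤ r - 3 →
      T a (u - 1) * T a (u + 1) = T (a - 1) u * T (a + 1) u)
    (hB : ∀ u : ℤ, T (r - 2) (u - 1) * T (r - 2) (u + 1)
      = T (r - 3) u * T (r - 1) u * T r u)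
    (hC : ∀ u : ℤ, T (r - 1) (u - 1) * T (r - 1) (u + 1) = T (r - 2) u)
    (hD : ∀ u : ℤ, T r (u - 1) * T r (u + 1) = T (r - 2) u) :
    (∀ a u, 1 ≤ a → a ≤ r →
      T a (u + (2 * (r : ℤ) - 2))
        = (T (if r % 2 = 1 ∧ r - 1 ≤ a then 2 * r - 1 - a else a) u)⁻¹) ∧
    (∀ a u, 1 ≤ a → a ≤ r →
      T a (u + 2 * (2 * (r : ℤ) - 2)) = T a u) := by
  obtain ⟨n, rfl⟩ : ∃ n, r = n + 3 := ⟨r - 3, by omega⟩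
  simp only [show n + 3 - 3 = n by omega, show n + 3 - 2 = n + 1 by omega,
    show n + 3 - 1 = n + 2 by omega] at hA hB hC hD ⊢
  obtain ⟨m1, m2, m3⟩ := aux_add (G := Additive G) n (by omega)
    (fun a u => Additive.ofMul (T a u)) h1
    (fun a u h h' => hA (a + 1) u (by omega) h') hB hC hD
  have m1 : ∀ a u, 1 ≤ a → a ≤ n + 1 → T a (u + (2 * (n : ℤ) + 4)) = (T a u)⁻¹ := m1
  have m2 : n % 2 = 0 → ∀ u, T (n + 2) (u + (2 * (n : ℤ) + 4)) = (T (n + 3) u)⁻¹ ∧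
      T (n + 3) (u + (2 * (n : ℤ) + 4)) = (T (n + 2) u)⁻¹ := m2
  have m3 : n % 2 = 1 → ∀ u, T (n + 2) (u + (2 * (n : ℤ) + 4)) = (T (n + 2) u)⁻¹ ∧
      T (n + 3) (u + (2 * (n : ℤ) + 4)) = (T (n + 3) u)⁻¹ := m3
  have e : 2 * ((n + 3 : ℕ) : ℤ) - 2 = 2 * (n : ℤ) + 4 := by push_cast; ring
  rw [e]
  have half : ∀ a u, 1 ≤ a → a ≤ n + 3 →
      T a (u + (2 * (n : ℤ) + 4))
        = (T (if (n + 3) % 2 = 1 ∧ n + 2 ≤ a then 2 * (n + 3) - 1 - a else a) u)⁻¹ := by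
    intro a u h h'
    rcases Nat.lt_or_ge a (n + 2) with g | g
    · rw [if_neg (by omega)]
      exact m1 a u h (by omega)
    · rcases Nat.mod_two_eq_zero_or_one n with p | p
      · rw [if_pos (by omega)]
        obtain rfl | rfl : a = n + 2 ∨ a = n + 3 := by omega
        · rw [show 2 * (n + 3) - 1 - (n + 2) = n + 3 by omega]; exact (m2 p u).1
        · rw [show 2 * (n + 3) - 1 - (n + 3) = n + 2 by omega]; exact (m2 p u).2
      · rw [if_neg (by omega)]
        obtain rfl | rfl : a = n + 2 ∨ a = n + 3 := by omega
        · exact (m3 p u).1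
        · exact (m3 p u).2
  refine ⟨half, fun a u h h' => ?_⟩
  rw [show u + 2 * (2 * (n : ℤ) + 4) = u + (2 * (n : ℤ) + 4) + (2 * (n : ℤ) + 4) by ring,
    half a _ h h']
  split_ifs with c
  · rw [half _ _ (by omega) (by omega), if_pos (by omega), inv_inv]
    congr 1; omega
  · rw [half _ _ h h', if_neg c, inv_inv]
end

section
/- Let G be an abelian group (written multiplicatively), r ≥ 2, and let Y^{(a)} : (1/2)ℤ → G (1 ≤ a ≤ r) be a family satisfying the level 0 restricted Y-system 𝕐_0(B_r): for all u ∈ (1/2)ℤ, Y^{(a)}(u−1)·Y^{(a)}(u+1) = Y^{(a−1)}(u)·Y^{(a+1)}(u) for 1 ≤ a ≤ r−2 (with Y^{(0)}(u) = 1); Y^{(r−1)}(u−1)·Y^{(r−1)}(u+1) = Y^{(r−2)}(u)·Y^{(r)}(u−1/2)·Y^{(r)}(u+1/2); and Y^{(r)}(u−1/2)·Y^{(r)}(u+1/2) = Y^{(r−1)}(u). Then: (1) half-periodicity: Y^{(a)}(u + 2r − 1) = Y^{(a)}(u)^{−1} for all 1 ≤ a ≤ r and u ∈ (1/2)ℤ;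 (2) periodicity: Y^{(a)}(u + 2(2r − 1)) = Y^{(a)}(u). -/
/-- Periodicity of the level 0 restricted Y-system `𝕐_0(B_r)` in an abelian group:
half-period `h^∨ = 2r−1` up to inversion, full period `2(2r−1)`.  The half-integer
spectral parameter `u ∈ (1/2)ℤ` is encoded by the integer `v = 2u`; a shift of `u`
by `1/2`, `1`, `2r−1` corresponds to a shift of `v` by `1`, `2`, `2(2r−1)`. -/
theorem restricted_Y0_Br_periodicity {G : Type*} [CommGroup G] (r : ℕ) (hr : 2 ≤ r)
    (Y : ℕ → ℤ → G)
    (h0 : ∀ v : ℤ, Y 0 v = 1)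
    (hA : ∀ a v, 1 ≤ a → a ≤ r - 2 →
      Y a (v - 2) * Y a (v + 2) = Y (a - 1) v * Y (a + 1) v)
    (hB : ∀ v : ℤ, Y (r - 1) (v - 2) * Y (r - 1) (v + 2)
      = Y (r - 2) v * Y r (v - 1) * Y r (v + 1))
    (hC : ∀ v : ℤ, Y r (v - 1) * Y r (v + 1) = Y (r - 1) v) :
    (∀ a v, 1 ≤ a → a ≤ r →
      Y a (v + 2 * (2 * (r : ℤ) - 1)) = (Y a v)⁻¹) ∧
    (∀ a v, 1 ≤ a → a ≤ r →
      Y a (v + 4 * (2 * (r : ℤ) - 1)) = Y a v) := by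
  have aux : ∀ e f g h w : G, e * f * (g * h) = w * (g * f) → w = e * h := by
    intro e f g h w H
    apply mul_right_cancel (b := g * f)
    rw [← H]
    ac_rfl
  have key : ∀ k : ℕ,
      (k + 1 ≤ r → ∀ v : ℤ, Y (r - (k + 1)) v = Y r (v - (2 * k + 1)) * Y r (v + (2 * k + 1))) ∧
      (k + 2 ≤ r → ∀ v : ℤ, Y (r - (k + 2)) v = Y r (v - (2 * k + 3)) * Y r (v + (2 * k + 3))) := by
    intro k
    induction k with
    | zero =>
      refine ⟨fun _ v => ?_, fun _ v => ?_⟩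
      · simpa using (hC v).symm
      · have H := hB v
        rw [← hC (v - 2), ← hC (v + 2)] at H
        apply aux _ (Y r (v - 1)) (Y r (v + 1))
        rw [show v - 2 - 1 = v - (2 * ((0 : ℕ) : ℤ) + 3) by push_cast; ring,
          show v - 2 + 1 = v - 1 by ring, show v + 2 - 1 = v + 1 by ring,
          show v + 2 + 1 = v + (2 * ((0 : ℕ) : ℤ) + 3) by push_cast; ring] at H
        rw [H]
        simp only [zero_add]
        ac_rfl
    | succ k ih =>
      obtain ⟨ih1, ih2⟩ := ih
      refine ⟨fun h v => ?_, fun h v => ?_⟩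
      · rw [show k + 1 + 1 = k + 2 by ring, ih2 (by omega) v]
        push_cast
        ring_nf
      · have H := hA (r - (k + 2)) v (by omega) (by omega)
        rw [show r - (k + 2) - 1 = r - (k + 1 + 2) by omega,
          show r - (k + 2) + 1 = r - (k + 1) by omega,
          ih2 (by omega), ih2 (by omega), ih1 (by omega)] at H
        apply aux _ (Y r (v + (2 * k + 1))) (Y r (v - (2 * k + 1)))
        rw [mul_comm (Y r (v - (2 * k + 1))) (Y r (v + (2 * k + 1)))] at H
        rw [mul_comm (Y r (v - (2 * k + 1))) (Y r (v + (2 * k + 1))), ← H]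
        push_cast
        congr 3 <;> ring
  have hx : ∀ v : ℤ, Y r (v + 2 * (2 * (r : ℤ) - 1)) = (Y r v)⁻¹ := by
    intro v
    obtain ⟨k, rfl⟩ : ∃ k, r = k + 1 := ⟨r - 1, by omega⟩
    have H := (key k).1 le_rfl (v + (2 * k + 1))
    rw [Nat.sub_self, h0, add_sub_cancel_right] at H
    rw [eq_inv_iff_mul_eq_one, mul_comm, H]
    push_cast
    congr 2
    ring
  have hall : ∀ a v, 1 ≤ a → a ≤ r → Y a (v + 2 * (2 * (r : ℤ) - 1)) = (Y a v)⁻¹ := by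
    intro a v h1 h2
    rcases Nat.lt_or_ge a r with h | h
    · obtain ⟨k, hk⟩ : ∃ k, r = a + (k + 1) := ⟨r - a - 1, by omega⟩
      have ha : a = r - (k + 1) := by omega
      have K := (key k).1 (by omega)
      rw [← ha] at K
      rw [K, K, mul_inv, ← hx, ← hx]
      congr 2 <;> ring
    · obtain rfl : a = r := by omega
      exact hx v
  refine ⟨hall, fun a v h1 h2 => ?_⟩
  have H := hall a (v + 2 * (2 * (r : ℤ) - 1)) h1 h2
  rw [hall a v h1 h2, inv_inv] at H
  rw [← H]
  congr 1
  ring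
end
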